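/- arXiv:1705.07502 — 7 statements merged into one kernel-verified Lean document; each statement's English description precedes it below -/
import Mathlib

section
/- Let p be a prime and let n ≥ 2. Let G be a transitive subgroup of the symmetric group on a finite set X with |X| = p^n, and suppose G contains a cyclic subgroup K that acts regularly on X. Then G is imprimitive or G is 2-transitive. -/
/-- A subgroup of the symmetric group on `X` is transitive if it acts
transitively on `X`. -/
def IsTransitivePermGroup {X : Type} (G : Subgroup (Equiv.Perm X)) : Prop :=
  ∀ x y : X, ∃ σ ∈ G, σ x = y

/-- A permutation group `G` on `X` is 2-transitive if it acts transitively on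
ordered pairs of distinct elements. -/
def IsTwoTransitivePermGroup {X : Type} (G : Subgroup (Equiv.Perm X)) : Prop :=
  ∀ x₁ x₂ y₁ y₂ : X, x₁ ≠ x₂ → y₁ ≠ y₂ → ∃ σ ∈ G, σ x₁ = y₁ ∧ σ x₂ = y₂

/-- `G` is imprimitive if there is a block `B` with `1 < |B| < |X|`. -/
def IsImprimitivePermGroup {X : Type} [Fintype X] (G : Subgroup (Equiv.Perm X)) : Prop :=
  ∃ B : Set X, (∀ σ ∈ G, ⇑σ '' B = B ∨ Disjoint (⇑σ '' B) B) ∧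
    1 < B.ncard ∧ B.ncard < Fintype.card X

/-- A subgroup `K` of the symmetric group on `X` acts regularly if it is
transitive and every point stabilizer in `K` is trivial. -/
def IsRegularPermSubgroup {X : Type} (K : Subgroup (Equiv.Perm X)) : Prop :=
  (∀ x y : X, ∃ σ ∈ K, σ x = y) ∧ (∀ σ ∈ K, ∀ x : X, σ x = x → σ = 1)

/-- A function on an additive group is difference-invariant under a set of permutations `H` if
the kernel `(x, y) ↦ f (y - x)` is invariant under the diagonal action of `H`. -/
def IsDifferenceInvariant {Z α : Type*} [AddGroup Z] (H : Subgroup (Equiv.Perm Z))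
    (f : Z → α) : Prop :=
  ∀ σ ∈ H, ∀ x y : Z, f (σ y - σ x) = f (y - x)

namespace IsDifferenceInvariant

open Finset

variable {Z α β γ : Type*} {H : Subgroup (Equiv.Perm Z)}

section AddGroup

variable [AddGroup Z]

theorem comp {f : Z → α} (hf : IsDifferenceInvariant H f) (g : α → β) :
    IsDifferenceInvariant H (fun z ↦ g (f z)) :=
  fun σ hσ x y ↦ congrArg g (hf σ hσ x y)

theorem comp₂ {f : Z → α} {f' : Z → β} (hf : IsDifferenceInvariant H f)
    (hf' : IsDifferenceInvariant H f') (g : α → β → γ) :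
    IsDifferenceInvariant H (fun z ↦ g (f z) (f' z)) :=
  fun σ hσ x y ↦ congrArg₂ g (hf σ hσ x y) (hf' σ hσ x y)

theorem eq_zero : IsDifferenceInvariant H (fun z : Z ↦ z = 0) := by
  intro σ _ x y
  simp [sub_eq_zero]

theorem closure {S : Set Z} (hS : IsDifferenceInvariant H (· ∈ S)) :
    IsDifferenceInvariant H (· ∈ AddSubgroup.closure S) := by
  have key : ∀ σ ∈ H, ∀ z ∈ AddSubgroup.closure S, ∀ x : Z,
      σ (z + x) - σ x ∈ AddSubgroup.closure S := by
    intro σ hσ z hz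
    induction hz using AddSubgroup.closure_induction with
    | mem z hz =>
      intro x
      refine AddSubgroup.subset_closure ((hS σ hσ x (z + x)).mpr ?_)
      simpa using hz
    | zero => simp
    | add a b _ _ ha hb =>
      intro x
      have := add_mem (ha (b + x)) (hb x)
      rwa [sub_add_sub_cancel, ← add_assoc] at this
    | neg a _ ha =>
      intro x
      have := neg_mem (ha (-a + x))
      rwa [neg_sub, add_neg_cancel_left] at this
  intro σ hσ x y
  refine propext ⟨fun h ↦ ?_, fun h ↦ ?_⟩
  · simpa using key σ⁻¹ (inv_mem hσ) _ h (σ x)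
  · simpa using key σ hσ _ h x

end AddGroup

section AddCommGroup

variable [AddCommGroup Z] [Fintype Z]

theorem sum_mul {R : Type*} [Semiring R] {f g : Z → R} (hf : IsDifferenceInvariant H f)
    (hg : IsDifferenceInvariant H g) :
    IsDifferenceInvariant H (fun z ↦ ∑ u, f u * g (z - u)) := by
  intro σ hσ x y
  calc ∑ u, f u * g (σ y - σ x - u)
      = ∑ u, f (σ u - σ x) * g (σ y - σ u) := by
        refine (Fintype.sum_equiv (σ.trans (Equiv.subRight (σ x))) _ _ fun u ↦ ?_).symm
        simp
    _ = ∑ u, f (u - x) * g (y - u) := by simp only [hf σ hσ, hg σ hσ]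
    _ = ∑ u, f u * g (y - x - u) := by
        refine Fintype.sum_equiv (Equiv.subRight x) _ _ fun u ↦ ?_
        simp

theorem coeff_mul {R : Type*} [Semiring R] {a b : AddMonoidAlgebra R Z}
    (ha : IsDifferenceInvariant H a.coeff) (hb : IsDifferenceInvariant H b.coeff) :
    IsDifferenceInvariant H (a * b).coeff := by
  convert ha.sum_mul hb using 1
  ext z
  rw [AddMonoidAlgebra.coeff_mul_apply_left, Finsupp.sum_fintype _ _ (by simp)]
  simp [neg_add_eq_sub]

theorem coeff_pow {R : Type*} [Semiring R] {a : AddMonoidAlgebra R Z}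
    (ha : IsDifferenceInvariant H a.coeff) (k : ℕ) :
    IsDifferenceInvariant H (a ^ k).coeff := by
  classical
  induction k with
  | zero =>
    convert (eq_zero (H := H)).comp (fun P : Prop ↦ if P then (1 : R) else 0) using 1
    ext z
    simp [AddMonoidAlgebra.one_def, Finsupp.single_apply, eq_comm]
  | succ k ih => rw [pow_succ]; exact ih.coeff_mul ha

/-- The `p`-th power map on the group algebra over `ZMod p` preserves difference-invariance. -/
theorem card_nsmul_fiber [DecidableEq Z] {p : ℕ} (hp : p.Prime) {O : Finset Z}
    (hO : IsDifferenceInvariant H (· ∈ O)) :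
    IsDifferenceInvariant H (fun y ↦ (#{x ∈ O | p • x = y} : ZMod p)) := by
  have : Fact p.Prime := ⟨hp⟩
  have : CharP (AddMonoidAlgebra (ZMod p) Z) p :=
    charP_of_injective_algebraMap (FaithfulSMul.algebraMap_injective (ZMod p) _) p
  let a : AddMonoidAlgebra (ZMod p) Z := ∑ x ∈ O, AddMonoidAlgebra.single x 1
  have ha : IsDifferenceInvariant H a.coeff := by
    convert hO.comp (fun P : Prop ↦ open Classical in if P then (1 : ZMod p) else 0) using 1
    ext z
    simp [a, AddMonoidAlgebra.coeff_sum, Finsupp.finsetSum_apply, Finsupp.single_apply]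
  convert ha.coeff_pow p using 1
  ext y
  simp [a, sum_pow_char, AddMonoidAlgebra.coeff_sum, Finsupp.finsetSum_apply,
    Finsupp.single_apply, Finset.sum_boole]

/-- The autocorrelation of a difference-invariant set is difference-invariant. -/
theorem card_add_mem [DecidableEq Z] {O : Finset Z} (hO : IsDifferenceInvariant H (· ∈ O)) :
    IsDifferenceInvariant H (fun y ↦ #{z ∈ O | z + y ∈ O}) := by
  have key (x y : Z) : #{z ∈ O | z + (y - x) ∈ O} = #{w | w - y ∈ O ∧ w - x ∈ O} := by
    refine card_equiv (Equiv.addRight y) fun z ↦ ?_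
    simp [add_sub_assoc]
  intro σ hσ x y
  simp only [key]
  refine (card_equiv σ fun w ↦ ?_).symm
  simp only [mem_filter, mem_univ, true_and]
  exact (and_congr (hO σ hσ y w).to_iff (hO σ hσ x w).to_iff).symm

end AddCommGroup

end IsDifferenceInvariant

open Finset in
theorem sum_card_add_mem {Z : Type*} [AddGroup Z] [Fintype Z] [DecidableEq Z] (O : Finset Z) :
    ∑ y, #{z ∈ O | z + y ∈ O} = #O * #O := by
  simp only [card_filter]
  rw [sum_comm, ← smul_eq_mul, ← sum_const]
  refine sum_congr rfl fun z _ ↦ ?_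
  rw [← card_filter]
  exact card_equiv (Equiv.addLeft z) fun y ↦ by simp

section Primitive

open Finset

variable {Z : Type*} [AddCommGroup Z] {H : Subgroup (Equiv.Perm Z)}

theorem eq_zero_of_subset_of_ne_top
    (hprim : ∀ L : AddSubgroup Z, IsDifferenceInvariant H (· ∈ L) → L = ⊥ ∨ L = ⊤)
    {S : Set Z} (hS : IsDifferenceInvariant H (· ∈ S))
    {M : AddSubgroup Z} (hM : M ≠ ⊤) (hSM : S ⊆ M) {z : Z} (hz : z ∈ S) : z = 0 := by
  rcases hprim _ hS.closure with h | h
  · simpa [h] using AddSubgroup.subset_closure hz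
  · exact absurd (top_le_iff.mp (h ▸ (AddSubgroup.closure_le M).mpr hSM)) hM

variable [Fintype Z] [DecidableEq Z]

/-- In the primitive case, a difference-invariant set is, away from the `p`-torsion, a union of
cosets of the `p`-torsion subgroup, provided the latter has order `p`. -/
theorem add_mem_of_nsmul_ne_zero
    (hprim : ∀ L : AddSubgroup Z, IsDifferenceInvariant H (· ∈ L) → L = ⊥ ∨ L = ⊤)
    {p : ℕ} (hp : p.Prime) (hcard : #{z : Z | p • z = 0} = p)
    {O : Finset Z} (hO : IsDifferenceInvariant H (· ∈ O))
    {x t : Z} (hx : x ∈ O) (hpx : p • x ≠ 0) (ht : p • t = 0) : x + t ∈ O := by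
  have hrange : (nsmulAddMonoidHom (α := Z) p).range ≠ ⊤ := by
    intro h
    have hinj : Function.Injective (nsmulAddMonoidHom (α := Z) p) :=
      Finite.injective_iff_surjective.mpr (AddMonoidHom.range_eq_top.mp h)
    have : #{z : Z | p • z = 0} ≤ 1 := by
      refine card_le_one.mpr fun a ha b hb ↦ hinj ?_
      simp_all
    exact hp.one_lt.not_ge (hcard ▸ this)
  have hfib : ((#{z ∈ O | p • z = p • x} : ℕ) : ZMod p) = 0 := by
    by_contra hne
    refine hpx (eq_zero_of_subset_of_ne_top hprim
      (S := {y | ((#{z ∈ O | p • z = y} : ℕ) : ZMod p) ≠ 0})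
      ((hO.card_nsmul_fiber hp).comp (· ≠ 0)) hrange ?_ hne)
    intro y hy
    have : #{z ∈ O | p • z = y} ≠ 0 := fun h ↦ hy (by simp [h])
    obtain ⟨z, hz⟩ := card_ne_zero.mp this
    exact ⟨z, (mem_filter.mp hz).2⟩
  have hpos : 0 < #{z ∈ O | p • z = p • x} := card_pos.mpr ⟨x, by simp [hx]⟩
  have hle : p ≤ #{z ∈ O | p • z = p • x} :=
    Nat.le_of_dvd hpos ((ZMod.natCast_eq_zero_iff _ _).mp hfib)
  have hcoset : #{z : Z | p • z = p • x} = p := by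
    refine Eq.trans (card_equiv (Equiv.subRight x) fun z ↦ ?_) hcard
    simp [smul_sub, sub_eq_zero]
  have hsub : ({z ∈ O | p • z = p • x} : Finset Z) = ({z : Z | p • z = p • x} : Finset Z) :=
    eq_of_subset_of_card_le (filter_subset_filter _ (subset_univ O)) (hcoset.le.trans hle)
  have : x + t ∈ ({z ∈ O | p • z = p • x} : Finset Z) := by
    rw [hsub]
    simp [smul_add, ht]
  exact (mem_filter.mp this).1

/-- In the primitive case, a nonempty difference-invariant set not containing `0` meets the
subgroup of `p`-torsion. -/
theorem exists_nsmul_eq_zero_of_mem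
    (hprim : ∀ L : AddSubgroup Z, IsDifferenceInvariant H (· ∈ L) → L = ⊥ ∨ L = ⊤)
    {p : ℕ} (hp : p.Prime) (hcard : #{z : Z | p • z = 0} = p)
    {O : Finset Z} (hO : IsDifferenceInvariant H (· ∈ O)) (h0 : (0 : Z) ∉ O)
    {x : Z} (hx : x ∈ O) : ∃ y ∈ O, p • y = 0 := by
  by_contra! hne
  let N : AddSubgroup Z :=
    { carrier := {y | ∀ z, z + y ∈ O ↔ z ∈ O}
      zero_mem' := by simp
      add_mem' := fun {a b} ha hb z ↦ by rw [← add_assoc, hb, ha]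
      neg_mem' := fun {a} ha z ↦ by rw [← ha (z + -a), neg_add_cancel_right] }
  have hmemN (y : Z) : y ∈ N ↔ ∀ z, z + y ∈ O ↔ z ∈ O := Iff.rfl
  have hsub (x y : Z) : y - x ∈ N ↔ ∀ w, w - x ∈ O ↔ w - y ∈ O := by
    rw [hmemN, ← (Equiv.subRight y).forall_congr_right]
    simp
  have hN : IsDifferenceInvariant H (· ∈ N) := by
    intro σ hσ x y
    refine propext ?_
    simp only [hsub]
    rw [← σ.forall_congr_right]
    exact forall_congr' fun w ↦ iff_congr (hO σ hσ x w).to_iff (hO σ hσ y w).to_iff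
  have htors (t : Z) (ht : p • t = 0) : t ∈ N := by
    refine fun z ↦ ⟨fun h ↦ ?_, fun h ↦ add_mem_of_nsmul_ne_zero hprim hp hcard hO h (hne z h) ht⟩
    simpa using add_mem_of_nsmul_ne_zero hprim hp hcard hO h (hne _ h) (t := -t) (by simp [ht])
  rcases hprim N hN with h | h
  · have : #{z : Z | p • z = 0} ≤ 1 := by
      refine card_le_one.mpr fun a ha b hb ↦ ?_
      have ha' := htors a (by simpa using ha)
      have hb' := htors b (by simpa using hb)
      rw [h, AddSubgroup.mem_bot] at ha' hb'
      rw [ha', hb']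
    exact hp.one_lt.not_ge (hcard ▸ this)
  · have hxN : x ∈ N := h ▸ AddSubgroup.mem_top x
    exact h0 ((hxN 0).mp (by simpa using hx))

/-- In the primitive case, a nonempty difference-invariant set not containing `0` has more than
`(|Z| - 1) / 2` elements. -/
theorem card_le_two_mul_card
    (hprim : ∀ L : AddSubgroup Z, IsDifferenceInvariant H (· ∈ L) → L = ⊥ ∨ L = ⊤)
    {p : ℕ} (hp : p.Prime) (hcard : #{z : Z | p • z = 0} = p) (hlt : p < Fintype.card Z)
    {O : Finset Z} (hO : IsDifferenceInvariant H (· ∈ O)) (h0 : (0 : Z) ∉ O)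
    (hne : O.Nonempty) : Fintype.card Z ≤ 2 * #O := by
  by_contra! hsmall
  set E : Finset Z := {z ∈ O | p • z ≠ 0}
  set D : Finset Z := {z ∈ O | p • z = 0}
  have hDE : #D + #E = #O := card_filter_add_card_filter_not _
  have hker : (nsmulAddMonoidHom (α := Z) p).ker ≠ ⊤ := by
    intro h
    have : ({z : Z | p • z = 0} : Finset Z) = univ :=
      filter_true_of_mem fun z _ ↦ by
        have : z ∈ (nsmulAddMonoidHom (α := Z) p).ker := h ▸ AddSubgroup.mem_top z
        simpa using this
    rw [this, card_univ] at hcard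
    omega
  have hadd {x t : Z} (hx : x ∈ E) (ht : p • t = 0) : x + t ∈ E := by
    obtain ⟨hxO, hpx⟩ := mem_filter.mp hx
    exact mem_filter.mpr ⟨add_mem_of_nsmul_ne_zero hprim hp hcard hO hxO hpx ht,
      by simpa [smul_add, ht] using hpx⟩
  have hEne : E.Nonempty := by
    by_contra h
    rw [not_nonempty_iff_eq_empty] at h
    obtain ⟨x, hx⟩ := hne
    refine h0 ((eq_zero_of_subset_of_ne_top hprim (S := ↑O) (by simpa using hO) hker ?_ hx) ▸ hx)
    intro z hz
    by_contra hpz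
    exact (h ▸ notMem_empty z) (mem_filter.mpr ⟨hz, by simpa using hpz⟩ : z ∈ E)
  have hpE : p ≤ #E := by
    obtain ⟨e, he⟩ := hEne
    rw [← hcard]
    exact card_le_card_of_injOn (e + ·) (fun t ht ↦ hadd he (by simpa using ht))
      (add_right_injective e).injOn
  have hDp : #D < p := by
    rw [← hcard]
    refine card_lt_card ⟨filter_subset_filter _ (subset_univ O), fun h ↦ h0 ?_⟩
    exact (mem_filter.mp (h (by simp : (0 : Z) ∈ _))).1
  have hcorr (y : Z) (hy : y ≠ 0) : #E ≤ #{z ∈ O | z + y ∈ O} := by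
    by_contra! hlt
    obtain ⟨t, ht, hpt⟩ := exists_nsmul_eq_zero_of_mem hprim hp hcard
      (O := {y | y ≠ 0 ∧ #{z ∈ O | z + y ∈ O} < #E})
      (by simpa using
        IsDifferenceInvariant.eq_zero.comp₂ hO.card_add_mem (fun P k ↦ ¬ P ∧ k < #E))
      (by simp) (x := y) (by simp [hy, hlt])
    refine (mem_filter.mp ht).2.2.not_ge (card_le_card fun z hz ↦ ?_)
    exact mem_filter.mpr ⟨(mem_filter.mp hz).1, (mem_filter.mp (hadd hz hpt)).1⟩
  have hsum : #O + (Fintype.card Z - 1) * #E ≤ #O * #O := by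
    rw [← sum_card_add_mem O, ← add_sum_erase univ _ (mem_univ 0)]
    refine add_le_add (by simp) ?_
    rw [← card_univ, ← card_erase_of_mem (mem_univ (0 : Z)), ← smul_eq_mul]
    exact card_nsmul_le_sum _ _ _ fun y hy ↦ hcorr y (ne_of_mem_erase hy)
  have hOpos : 0 < #O := hne.card_pos
  have h1 : #O * (1 + 2 * #E) ≤ #O * #O := by
    have : 2 * #O * #E ≤ (Fintype.card Z - 1) * #E := Nat.mul_le_mul_right _ (by omega)
    nlinarith
  have := Nat.le_of_mul_le_mul_left h1 hOpos
  omega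

/-- In the primitive case, a point stabilizer is transitive on the remaining points. -/
theorem exists_map_zero_map_eq
    (hprim : ∀ L : AddSubgroup Z, IsDifferenceInvariant H (· ∈ L) → L = ⊥ ∨ L = ⊤)
    (htrans : ∀ a : Z, Equiv.addRight a ∈ H)
    {p : ℕ} (hp : p.Prime) (hcard : #{z : Z | p • z = 0} = p) (hlt : p < Fintype.card Z)
    {a b : Z} (ha : a ≠ 0) (hb : b ≠ 0) : ∃ σ ∈ H, σ 0 = 0 ∧ σ a = b := by
  classical
  let r (z : Z) : Prop := ∃ σ ∈ H, σ 0 = 0 ∧ σ a = z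
  have hr : IsDifferenceInvariant H r := by
    have key : ∀ σ ∈ H, ∀ x y : Z, r (y - x) → r (σ y - σ x) := by
      rintro σ hσ x y ⟨τ, hτ, hτ0, hτa⟩
      refine ⟨Equiv.addRight (-σ x) * σ * Equiv.addRight x * τ,
        mul_mem (mul_mem (mul_mem (htrans _) hσ) (htrans _)) hτ, ?_, ?_⟩
      · simp [hτ0]
      · simp [hτa, sub_eq_add_neg]
    intro σ hσ x y
    refine propext ⟨fun h ↦ ?_, key σ hσ x y⟩
    simpa using key σ⁻¹ (inv_mem hσ) (σ x) (σ y) h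
  have hr0 : ¬ r 0 := fun ⟨σ, _, h0, h⟩ ↦ ha (σ.injective (h.trans h0.symm))
  by_contra hrb
  have h1 := card_le_two_mul_card hprim hp hcard hlt (O := {z | r z}) (by simpa using hr)
    (by simpa using hr0) ⟨a, by simpa using ⟨1, one_mem H, rfl, rfl⟩⟩
  have h2 := card_le_two_mul_card hprim hp hcard hlt (O := {z | ¬ z = 0 ∧ ¬ r z})
    (by simpa using IsDifferenceInvariant.eq_zero.comp₂ hr (fun P Q ↦ ¬ P ∧ ¬ Q))
    (by simp) ⟨b, by simpa using ⟨hb, hrb⟩⟩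
  have hdisj : Disjoint ({z | r z} : Finset Z) ({z | ¬ z = 0 ∧ ¬ r z} : Finset Z) := by
    simp +contextual [disjoint_left]
  have h3 : #({z | r z} : Finset Z) + #({z | ¬ z = 0 ∧ ¬ r z} : Finset Z) < Fintype.card Z := by
    rw [← card_union_of_disjoint hdisj, ← card_univ]
    refine card_lt_card ((ssubset_univ_iff).mpr fun h ↦ ?_)
    have : (0 : Z) ∈ ({z | r z} : Finset Z) ∪ ({z | ¬ z = 0 ∧ ¬ r z} : Finset Z) := by
      rw [h]; exact mem_univ 0
    simp [hr0] at this
  omega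

end Primitive

theorem isImprimitivePermGroup_of_addSubgroup {X Z : Type} [Fintype X] [AddGroup Z]
    {G : Subgroup (Equiv.Perm X)} (e : Z ≃ X) {L : AddSubgroup Z}
    (hL : IsDifferenceInvariant (G.comap e.permCongrHom.toMonoidHom) (· ∈ L))
    (hbot : L ≠ ⊥) (htop : L ≠ ⊤) : IsImprimitivePermGroup G := by
  have : Finite Z := Finite.of_equiv X e.symm
  refine ⟨e '' L, fun σ hσ ↦ ?_, ?_, ?_⟩
  · rw [or_iff_not_imp_right, Set.not_disjoint_iff]
    rintro ⟨_, ⟨_, ⟨a, ha, rfl⟩, rfl⟩, ⟨b, hb, hab⟩⟩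
    let τ : Equiv.Perm Z := (e.trans σ).trans e.symm
    have hτ : τ ∈ G.comap e.permCongrHom.toMonoidHom := by
      have : e.permCongrHom τ = σ := by ext x; simp [τ]
      simpa [Subgroup.mem_comap, this] using hσ
    have hτa : τ a = b := by simp [τ, ← hab]
    have hmem (y : Z) : τ y ∈ L ↔ y ∈ L := by
      have : τ y - τ a ∈ L ↔ y - a ∈ L := (hL τ hτ a y).to_iff
      rwa [hτa, sub_eq_add_neg, sub_eq_add_neg, L.add_mem_cancel_right (L.neg_mem hb),
        L.add_mem_cancel_right (L.neg_mem ha)] at this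
    ext x
    obtain ⟨z, rfl⟩ := (e.trans σ).surjective x
    have hz : (e.trans σ) z = e (τ z) := by simp [τ]
    rw [hz, e.injective.mem_set_image, SetLike.mem_coe, hmem, ← hz, Equiv.coe_trans,
      Function.comp_apply, σ.injective.mem_set_image, e.injective.mem_set_image, SetLike.mem_coe]
  · rw [Set.ncard_image_of_injective _ e.injective]
    have := (AddSubgroup.one_lt_card_iff_ne_bot L).mpr hbot
    exact this
  · rw [Set.ncard_image_of_injective _ e.injective, ← Nat.card_eq_fintype_card,
      ← Nat.card_congr e]
    refine Set.ncard_lt_card fun h ↦ htop ?_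
    exact SetLike.coe_injective h

theorem card_filter_nsmul_eq_zero_zmod {m p : ℕ} [NeZero m] (hpm : p ∣ m) :
    (Finset.univ.filter fun z : ZMod m ↦ p • z = 0).card = p := by
  have h := IsAddCyclic.card_nsmulAddMonoidHom_ker (ZMod m) p
  rw [Nat.card_zmod, Nat.gcd_eq_right hpm] at h
  rw [← Fintype.card_subtype, ← Nat.card_eq_fintype_card]
  exact h

theorem burnside_prime_power_cyclic
    (p n : ℕ) (hp : p.Prime) (hn : 2 ≤ n)
    (X : Type) [Fintype X] (hX : Fintype.card X = p ^ n)
    (G K : Subgroup (Equiv.Perm X))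
    (hG : IsTransitivePermGroup G) (hKG : K ≤ G)
    (hcyc : IsCyclic K) (hreg : IsRegularPermSubgroup K) :
    IsImprimitivePermGroup G ∨ IsTwoTransitivePermGroup G := by
  have hp1 : 0 < p ^ n := pow_pos hp.pos n
  have : NeZero (p ^ n) := ⟨hp1.ne'⟩
  obtain ⟨x₀⟩ : Nonempty X := Fintype.card_pos_iff.mp (hX ▸ hp1)
  have hbij : Function.Bijective fun k : K ↦ (k : Equiv.Perm X) x₀ := by
    refine ⟨fun k l h ↦ ?_, fun y ↦ ?_⟩
    · have := hreg.2 _ (K.mul_mem (K.inv_mem l.2) k.2) x₀ (by simp_all)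
      exact Subtype.ext (inv_mul_eq_one.mp this).symm
    · obtain ⟨σ, hσ, h⟩ := hreg.1 x₀ y
      exact ⟨⟨σ, hσ⟩, h⟩
  have hK : Nat.card K = p ^ n := by
    rw [Nat.card_congr (Equiv.ofBijective _ hbij), Nat.card_eq_fintype_card, hX]
  let φ : Multiplicative (ZMod (p ^ n)) ≃* K := hK ▸ zmodCyclicMulEquiv hcyc
  let e : ZMod (p ^ n) ≃ X :=
    (Multiplicative.ofAdd.trans φ.toEquiv).trans (Equiv.ofBijective _ hbij)
  have he (z : ZMod (p ^ n)) : e z = (φ (Multiplicative.ofAdd z) : Equiv.Perm X) x₀ := rfl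
  have htrans (a : ZMod (p ^ n)) :
      Equiv.addRight a ∈ G.comap e.permCongrHom.toMonoidHom := by
    have : e.permCongrHom (Equiv.addRight a) = φ (Multiplicative.ofAdd a) := by
      ext x
      obtain ⟨z, rfl⟩ := e.surjective x
      change e (e.symm (e z) + a) = _
      rw [e.symm_apply_apply, add_comm, he, he, ofAdd_add, map_mul]
      rfl
    refine hKG ?_
    change e.permCongrHom (Equiv.addRight a) ∈ K
    rw [this]
    exact (φ (Multiplicative.ofAdd a)).2
  rw [or_iff_not_imp_left]
  intro hG_prim
  have hprim (L : AddSubgroup (ZMod (p ^ n)))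
      (hL : IsDifferenceInvariant (G.comap e.permCongrHom.toMonoidHom) (· ∈ L)) :
      L = ⊥ ∨ L = ⊤ := by
    by_contra! h
    exact hG_prim (isImprimitivePermGroup_of_addSubgroup e hL h.1 h.2)
  intro x₁ x₂ y₁ y₂ hx hy
  obtain ⟨a₁, rfl⟩ := e.surjective x₁
  obtain ⟨a₂, rfl⟩ := e.surjective x₂
  obtain ⟨b₁, rfl⟩ := e.surjective y₁
  obtain ⟨b₂, rfl⟩ := e.surjective y₂
  obtain ⟨σ, hσ, h0, hab⟩ := exists_map_zero_map_eq hprim htrans hp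
    (card_filter_nsmul_eq_zero_zmod (dvd_pow_self p (by omega)))
    (by rw [ZMod.card]; exact lt_self_pow₀ hp.one_lt (by omega))
    (a := a₂ - a₁) (b := b₂ - b₁)
    (sub_ne_zero.mpr fun h ↦ hx (by rw [h])) (sub_ne_zero.mpr fun h ↦ hy (by rw [h]))
  refine ⟨_, mul_mem (mul_mem (htrans b₁) hσ) (htrans (-a₁)), ?_, ?_⟩
  · simp [h0]
  · simp [← sub_eq_add_neg, hab]
end

section
/- Let d be a positive integer that is not a prime power (i.e., d has at least two distinct prime divisors). Let G be a transitive subgroup of the symmetric group on a finite set X with |X| = d, and suppose G contains a cyclic subgroup K that acts regularly on X. Then G is imprimitive or G is 2-transitive. -/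
section PointStabilizer

variable {C : Type*} [CommGroup C]

/-- A set is invariant under the stabilizer of `1` in `G`. -/
def IsStabInvariant (G : Subgroup (Equiv.Perm C)) (T : Set C) : Prop :=
  ∀ σ ∈ G, σ 1 = 1 → ∀ x, σ x ∈ T ↔ x ∈ T

/-- A function is constant on the orbits of the stabilizer of `1` in `G`. -/
def IsStabInvariantFun {R : Type*} (G : Subgroup (Equiv.Perm C)) (f : C → R) : Prop :=
  ∀ σ ∈ G, σ 1 = 1 → ∀ x, f (σ x) = f x

variable {G : Subgroup (Equiv.Perm C)}

theorem exists_stab_conj (hC : ∀ c, Equiv.mulLeft c ∈ G) {σ : Equiv.Perm C} (hσ : σ ∈ G) (x : C) :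
    ∃ τ ∈ G, τ 1 = 1 ∧ ∀ y, σ (x * y) = σ x * τ y :=
  ⟨Equiv.mulLeft (σ x)⁻¹ * σ * Equiv.mulLeft x, G.mul_mem (G.mul_mem (hC _) hσ) (hC _),
    by simp, by simp⟩

theorem isStabInvariant_of_forall {T : Set C}
    (h : ∀ σ ∈ G, σ 1 = 1 → ∀ x ∈ T, σ x ∈ T) : IsStabInvariant G T := by
  intro σ hσ h1 x
  refine ⟨fun hx => ?_, h σ hσ h1 x⟩
  have := h σ⁻¹ (G.inv_mem hσ) (by rw [Equiv.Perm.inv_eq_iff_eq, h1]) _ hx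
  simpa using this

theorem IsStabInvariant.closure (hC : ∀ c, Equiv.mulLeft c ∈ G) {S : Set C}
    (hS : IsStabInvariant G S) : IsStabInvariant G (Subgroup.closure S : Set C) := by
  have key : ∀ x ∈ Subgroup.closure S, ∀ σ ∈ G, σ 1 = 1 → σ x ∈ Subgroup.closure S := by
    intro x hx
    induction hx using Subgroup.closure_induction with
    | mem x hx => exact fun σ hσ h1 => Subgroup.subset_closure ((hS σ hσ h1 x).2 hx)
    | one => exact fun σ _ h1 => h1.symm ▸ Subgroup.one_mem _
    | mul x y _ _ ihx ihy =>
      intro σ hσ h1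
      obtain ⟨τ, hτ, hτ1, h⟩ := exists_stab_conj hC hσ x
      rw [h]
      exact Subgroup.mul_mem _ (ihx σ hσ h1) (ihy τ hτ hτ1)
    | inv x _ ih =>
      intro σ hσ h1
      obtain ⟨τ, hτ, hτ1, h⟩ := exists_stab_conj hC hσ x⁻¹
      have hx := h x
      rw [inv_mul_cancel, h1] at hx
      rw [eq_inv_of_mul_eq_one_left hx.symm]
      exact Subgroup.inv_mem _ (ih τ hτ hτ1)
  exact isStabInvariant_of_forall fun σ hσ h1 x hx => key x hx σ hσ h1

theorem IsStabInvariant.stabilizer (hC : ∀ c, Equiv.mulLeft c ∈ G) {T : Set C}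
    (hT : IsStabInvariant G T) :
    IsStabInvariant G {c | ∀ t, c * t ∈ T ↔ t ∈ T} := by
  refine isStabInvariant_of_forall fun σ hσ h1 c hc t => ?_
  obtain ⟨τ, hτ, hτ1, h⟩ := exists_stab_conj hC hσ c
  obtain ⟨s, rfl⟩ := τ.surjective t
  rw [← h, hT σ hσ h1, hT τ hτ hτ1]
  exact hc s

theorem IsStabInvariantFun.mul [Fintype C] {R : Type*} [CommRing R]
    (hC : ∀ c, Equiv.mulLeft c ∈ G) {f g : MonoidAlgebra R C}
    (hf : IsStabInvariantFun G f.coeff) (hg : IsStabInvariantFun G g.coeff) :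
    IsStabInvariantFun G (f * g).coeff := by
  classical
  have conv : ∀ x, (f * g).coeff x = ∑ y, f.coeff y * g.coeff (y⁻¹ * x) := by
    intro x
    rw [MonoidAlgebra.coeff_mul, Finsupp.sum_fintype _ _ (by simp)]
    refine Finset.sum_congr rfl fun y _ => ?_
    rw [Finsupp.sum_fintype _ _ (by simp)]
    simp [← eq_inv_mul_iff_mul_eq]
  intro σ hσ h1 x
  rw [conv, conv, ← Equiv.sum_comp σ]
  refine Finset.sum_congr rfl fun y _ => ?_
  obtain ⟨τ, hτ, hτ1, h⟩ := exists_stab_conj hC hσ y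
  have hx := h (y⁻¹ * x)
  rw [mul_inv_cancel_left] at hx
  rw [hf σ hσ h1, hx, inv_mul_cancel_left, hg τ hτ hτ1]

theorem IsStabInvariantFun.pow [Fintype C] {R : Type*} [CommRing R]
    (hC : ∀ c, Equiv.mulLeft c ∈ G) {f : MonoidAlgebra R C}
    (hf : IsStabInvariantFun G f.coeff) (n : ℕ) : IsStabInvariantFun G (f ^ n).coeff := by
  classical
  induction n with
  | zero =>
    intro σ _ h1 x
    have : (1 : C) = σ x ↔ 1 = x := by
      nth_rewrite 1 [← h1]
      exact σ.injective.eq_iff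
    simp only [pow_zero, MonoidAlgebra.one_def, MonoidAlgebra.coeff_single, Finsupp.single_apply,
      this]
  | succ n ih => rw [pow_succ]; exact ih.mul hC hf

/-- The elements that are `p`-th powers of elements of `T` with multiplicity prime to `p`
form an invariant set. -/
theorem IsStabInvariant.pow_prime [Fintype C] [DecidableEq C] (hC : ∀ c, Equiv.mulLeft c ∈ G)
    {T : Finset C} (hT : IsStabInvariant G (T : Set C)) {p : ℕ} (hp : p.Prime) :
    IsStabInvariant G {x | ¬ p ∣ (T.filter fun t => t ^ p = x).card} := by
  have := Fact.mk hp
  let f : MonoidAlgebra (ZMod p) C := ∑ t ∈ T, MonoidAlgebra.single t 1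
  have hf : IsStabInvariantFun G f.coeff := by
    have : ∀ x, f.coeff x = if x ∈ T then 1 else 0 := by
      intro x
      simp [f, Finsupp.single_apply, Finsupp.finsetSum_apply]
    intro σ hσ h1 x
    have := hT σ hσ h1 x
    simp_all
  have hpow : ∀ x, (f ^ p).coeff x = ((T.filter fun t => t ^ p = x).card : ZMod p) := by
    intro x
    have : CharP (MonoidAlgebra (ZMod p) C) p :=
      charP_of_injective_algebraMap (algebraMap (ZMod p) _).injective p
    simp [f, sum_pow_char, MonoidAlgebra.single_pow, Finsupp.single_apply,
      Finsupp.finsetSum_apply]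
  intro σ hσ h1 x
  have := hf.pow hC p σ hσ h1 x
  rw [hpow, hpow] at this
  simp only [Set.mem_ofPred_eq, ← CharP.cast_eq_zero_iff (ZMod p) p, this]

theorem range_pow_ne_top [Finite C] {p : ℕ} (hp : p.Prime) (hpC : p ∣ Nat.card C) :
    (powMonoidHom p : C →* C).range ≠ ⊤ := by
  have := Fact.mk hp
  intro h
  obtain ⟨z, hz⟩ := exists_prime_orderOf_dvd_card' p hpC
  have hinj := Finite.injective_iff_surjective.2 (MonoidHom.range_eq_top.1 h)
  have : z = 1 := hinj (by simp [← hz, pow_orderOf_eq_one])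
  rw [this, orderOf_one] at hz
  exact hp.one_lt.ne hz

/-- If `G` is primitive, an invariant set is a union of cosets of the `p`-torsion, away from the
`p`-torsion itself. -/
theorem IsStabInvariant.mul_mem_of_pow_eq_one [Fintype C] [IsCyclic C]
    (hC : ∀ c, Equiv.mulLeft c ∈ G)
    (hprim : ∀ H : Subgroup C, IsStabInvariant G (H : Set C) → H = ⊥ ∨ H = ⊤)
    {T : Set C} (hT : IsStabInvariant G T) {p : ℕ} (hp : p.Prime) (hpC : p ∣ Nat.card C)
    {t z : C} (ht : t ∈ T) (htp : t ^ p ≠ 1) (hz : z ^ p = 1) : z * t ∈ T := by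
  classical
  lift T to Finset C using T.toFinite
  set S := {x | ¬ p ∣ (T.filter fun t => t ^ p = x).card} with hS
  have hle : Subgroup.closure S ≤ (powMonoidHom p : C →* C).range := by
    rw [Subgroup.closure_le]
    intro x hx
    by_contra hx'
    apply hx
    rw [Finset.filter_eq_empty_iff.2, Finset.card_empty]
    · exact dvd_zero p
    · exact fun s _ hs => hx' ⟨s, hs⟩
  have hbot : Subgroup.closure S = ⊥ := by
    refine (hprim _ ((hT.pow_prime hC hp).closure hC)).resolve_right fun h => ?_
    exact range_pow_ne_top hp hpC (top_le_iff.1 (h ▸ hle))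
  have hdvd : p ∣ (T.filter fun s => s ^ p = t ^ p).card := by
    by_contra h
    exact htp ((Subgroup.closure_eq_bot_iff.1 hbot) h)
  have hcard : (Finset.univ.filter fun s : C => s ^ p = t ^ p).card ≤ p := by
    refine le_trans ?_ (IsCyclic.card_pow_eq_one_le (α := C) hp.pos)
    refine Finset.card_le_card_of_injOn (· * t⁻¹) ?_ (mul_left_injective _).injOn
    intro s hs
    simp_all [mul_pow]
  have hpos : 0 < (T.filter fun s => s ^ p = t ^ p).card :=
    Finset.card_pos.2 ⟨t, by simpa using ht⟩
  have heq := Finset.eq_of_subset_of_card_le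
    (Finset.filter_subset_filter (fun s => s ^ p = t ^ p) (Finset.subset_univ T))
    (hcard.trans (Nat.le_of_dvd hpos hdvd))
  have hmem : z * t ∈ Finset.univ.filter fun s : C => s ^ p = t ^ p := by
    simp [mul_pow, hz]
  rw [← heq] at hmem
  exact (Finset.mem_filter.1 hmem).1

/-- If `G` is primitive, a nonempty invariant set avoiding `1` meets the `p`-torsion. -/
theorem IsStabInvariant.exists_pow_eq_one [Fintype C] [IsCyclic C]
    (hC : ∀ c, Equiv.mulLeft c ∈ G)
    (hprim : ∀ H : Subgroup C, IsStabInvariant G (H : Set C) → H = ⊥ ∨ H = ⊤)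
    {T : Set C} (hT : IsStabInvariant G T) (hne : T.Nonempty) (h1 : (1 : C) ∉ T)
    {p : ℕ} (hp : p.Prime) (hpC : p ∣ Nat.card C) : ∃ y ∈ T, y ^ p = 1 := by
  have := Fact.mk hp
  by_contra! h
  obtain ⟨z, hz⟩ := exists_prime_orderOf_dvd_card' p hpC
  have hzp : z ^ p = 1 := hz ▸ pow_orderOf_eq_one z
  let H : Subgroup C :=
    { carrier := {c | ∀ t, c * t ∈ T ↔ t ∈ T}
      one_mem' := by simp
      mul_mem' := fun {a b} ha hb t => by rw [mul_assoc, ha, hb]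
      inv_mem' := fun {a} ha t => by rw [← ha (a⁻¹ * t), mul_inv_cancel_left] }
  have hzH : z ∈ H := by
    intro t
    refine ⟨fun ht => ?_, fun ht => hT.mul_mem_of_pow_eq_one hC hprim hp hpC ht (h t ht) hzp⟩
    have := hT.mul_mem_of_pow_eq_one hC hprim hp hpC ht (h _ ht) (z := z⁻¹) (by simp [hzp])
    rwa [inv_mul_cancel_left] at this
  obtain ⟨t, ht⟩ := hne
  rcases hprim H (hT.stabilizer hC) with hH | hH
  · rw [hH, Subgroup.mem_bot] at hzH
    rw [hzH, orderOf_one] at hz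
    exact hp.one_lt.ne hz
  · have : t⁻¹ ∈ H := hH ▸ Subgroup.mem_top _
    exact h1 (by simpa using (this t).2 ht)

theorem exists_stab_map_eq [Fintype C] [IsCyclic C] (hC : ∀ c, Equiv.mulLeft c ∈ G)
    (hprim : ∀ H : Subgroup C, IsStabInvariant G (H : Set C) → H = ⊥ ∨ H = ⊤)
    {p q : ℕ} (hp : p.Prime) (hq : q.Prime) (hpq : p ≠ q)
    (hpC : p ∣ Nat.card C) (hqC : q ∣ Nat.card C) {a b : C} (ha : a ≠ 1) (hb : b ≠ 1) :
    ∃ σ ∈ G, σ 1 = 1 ∧ σ a = b := by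
  have := Fact.mk hp
  obtain ⟨z, hz⟩ := exists_prime_orderOf_dvd_card' p hpC
  have hzp : z ^ p = 1 := hz ▸ pow_orderOf_eq_one z
  have hz1 : z ≠ 1 := fun h => hp.one_lt.ne (by rw [← hz, h, orderOf_one])
  have coprime_torsion : ∀ x : C, x ^ p = 1 → x ^ q = 1 → x = 1 := by
    intro x hxp hxq
    rw [← orderOf_eq_one_iff, ← Nat.dvd_one, ← (Nat.coprime_primes hp hq).2 hpq]
    exact Nat.dvd_gcd (orderOf_dvd_of_pow_eq_one hxp) (orderOf_dvd_of_pow_eq_one hxq)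
  have key : ∀ c : C, c ≠ 1 → ∃ σ ∈ G, σ 1 = 1 ∧ σ c = z := by
    intro c hc
    let T : Set C := {x | ∃ σ ∈ G, σ 1 = 1 ∧ σ c = x}
    have hT : IsStabInvariant G T := by
      refine isStabInvariant_of_forall ?_
      rintro σ hσ h1 _ ⟨τ, hτ, hτ1, rfl⟩
      exact ⟨σ * τ, G.mul_mem hσ hτ, by simp [hτ1, h1], by simp⟩
    have hT1 : (1 : C) ∉ T := by
      rintro ⟨σ, -, h1, h⟩
      exact hc (σ.injective (h.trans h1.symm))
    obtain ⟨y, hyT, hyq⟩ := hT.exists_pow_eq_one hC hprim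
      ⟨c, 1, G.one_mem, rfl, rfl⟩ hT1 hq hqC
    have hyp : y ^ p ≠ 1 := fun h => hT1 (coprime_torsion y h hyq ▸ hyT)
    have hzy : z * y ∈ T := hT.mul_mem_of_pow_eq_one hC hprim hp hpC hyT hyp hzp
    have hzyq : (z * y) ^ q ≠ 1 := by
      rw [mul_pow, hyq, mul_one]
      exact fun h => hz1 (coprime_torsion z hzp h)
    have := hT.mul_mem_of_pow_eq_one hC hprim hq hqC hzy hzyq (z := y⁻¹) (by simp [hyq])
    rwa [mul_comm z, inv_mul_cancel_left] at this
  obtain ⟨σ, hσ, hσ1, hσa⟩ := key a ha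
  obtain ⟨τ, hτ, hτ1, hτb⟩ := key b hb
  refine ⟨τ⁻¹ * σ, G.mul_mem (G.inv_mem hτ) hσ, ?_, ?_⟩
  · rw [Equiv.Perm.mul_apply, hσ1, Equiv.Perm.inv_eq_iff_eq, hτ1]
  · rw [Equiv.Perm.mul_apply, hσa, Equiv.Perm.inv_eq_iff_eq, hτb]

theorem IsStabInvariant.isBlock (hC : ∀ c, Equiv.mulLeft c ∈ G) {H : Subgroup C}
    (hH : IsStabInvariant G (H : Set C)) {σ : Equiv.Perm C} (hσ : σ ∈ G) :
    σ '' H = H ∨ Disjoint (σ '' H) (H : Set C) := by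
  refine or_iff_not_imp_right.2 fun hd => ?_
  obtain ⟨_, ⟨h, hh, rfl⟩, hσh⟩ := Set.not_disjoint_iff.1 hd
  obtain ⟨τ, hτ, hτ1, hmul⟩ := exists_stab_conj hC hσ h
  ext x
  rw [← σ.symm_symm, Equiv.image_symm_eq_preimage, Set.mem_preimage]
  obtain ⟨y, rfl⟩ := σ.surjective x
  obtain ⟨w, rfl⟩ : ∃ w, y = h * w := ⟨h⁻¹ * y, by simp⟩
  rw [σ.symm_apply_apply, hmul]
  simp only [SetLike.mem_coe] at *
  rw [H.mul_mem_cancel_left hh, H.mul_mem_cancel_left hσh]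
  exact (hH τ hτ hτ1 w).symm

end PointStabilizer

theorem exists_prime_ne_dvd_of_not_isPrimePow {d : ℕ} (h1 : d ≠ 1) (h : ¬ IsPrimePow d) :
    ∃ p q : ℕ, p.Prime ∧ q.Prime ∧ p ≠ q ∧ p ∣ d ∧ q ∣ d := by
  obtain ⟨p, hp, hpd⟩ := Nat.exists_prime_and_dvd h1
  by_contra! hcon
  exact h (isPrimePow_iff_unique_prime_dvd.2
    ⟨p, ⟨hp, hpd⟩, fun q hq => by_contra fun hne => hcon p q hp hq.1 (Ne.symm hne) hpd hq.2⟩)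

theorem burnside_non_prime_power_cyclic
    (d : ℕ) (hd : 0 < d) (hnpp : ¬ IsPrimePow d)
    (X : Type) [Fintype X] (hX : Fintype.card X = d)
    (G K : Subgroup (Equiv.Perm X))
    (hG : IsTransitivePermGroup G) (hKG : K ≤ G)
    (hcyc : IsCyclic K) (hreg : IsRegularPermSubgroup K) :
    IsImprimitivePermGroup G ∨ IsTwoTransitivePermGroup G := by
  classical
  subst hX
  rcases eq_or_ne (Fintype.card X) 1 with h1 | h1
  · right
    intro x₁ x₂ _ _ hx
    exact absurd ((Fintype.card_le_one_iff.1 h1.le) x₁ x₂) hx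
  obtain ⟨p, q, hp, hq, hpq, hpX, hqX⟩ := exists_prime_ne_dvd_of_not_isPrimePow h1 hnpp
  obtain ⟨x₀⟩ := Fintype.card_pos_iff.1 hd
  let : CommGroup K := IsCyclic.commGroup
  let e : K ≃ X := Equiv.ofBijective (fun k => (k : Equiv.Perm X) x₀) <| by
    refine ⟨fun a b hab => ?_, fun x => ?_⟩
    · refine (inv_mul_eq_one.1 (Subtype.ext (hreg.2 _ (a⁻¹ * b).2 x₀ ?_)))
      exact Equiv.Perm.inv_eq_iff_eq.2 hab.symm
    · obtain ⟨σ, hσ, h⟩ := hreg.1 x₀ x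
      exact ⟨⟨σ, hσ⟩, h⟩
  have he_mul : ∀ a b : K, e (a * b) = (a : Equiv.Perm X) (e b) := fun a b => rfl
  let : Fintype K := Fintype.ofEquiv X e.symm
  have hcard : Nat.card K = Fintype.card X := by
    rw [Nat.card_congr e, Nat.card_eq_fintype_card]
  let G' : Subgroup (Equiv.Perm K) := G.comap (e.permCongrHom : Equiv.Perm K →* Equiv.Perm X)
  have hmem : ∀ σ ∈ G, e.symm.permCongr σ ∈ G' := by
    intro σ hσ
    have : e.permCongr (e.symm.permCongr σ) = σ := by ext; simp
    exact Subgroup.mem_comap.2 (by simpa [Equiv.permCongrHom, this] using hσ)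
  have hC : ∀ c : K, Equiv.mulLeft c ∈ G' := by
    intro c
    have : e.permCongr (Equiv.mulLeft c) = c := by
      ext x
      obtain ⟨k, rfl⟩ := e.surjective x
      simp [he_mul]
    exact Subgroup.mem_comap.2 (this ▸ hKG c.2)
  by_cases hprim : ∀ H : Subgroup K, IsStabInvariant G' (H : Set K) → H = ⊥ ∨ H = ⊤
  · right
    intro x₁ x₂ y₁ y₂ hx hy
    obtain ⟨a₁, rfl⟩ := e.surjective x₁
    obtain ⟨a₂, rfl⟩ := e.surjective x₂
    obtain ⟨b₁, rfl⟩ := e.surjective y₁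
    obtain ⟨b₂, rfl⟩ := e.surjective y₂
    have ha : a₁⁻¹ * a₂ ≠ 1 := fun h => hx (by rw [inv_mul_eq_one.1 h])
    have hb : b₁⁻¹ * b₂ ≠ 1 := fun h => hy (by rw [inv_mul_eq_one.1 h])
    obtain ⟨τ, hτ, hτ1, hτa⟩ := exists_stab_map_eq hC hprim hp hq hpq
      (hcard ▸ hpX) (hcard ▸ hqX) ha hb
    refine ⟨_, Subgroup.mem_comap.1
      (G'.mul_mem (G'.mul_mem (hC b₁) hτ) (hC a₁⁻¹)), ?_, ?_⟩
    · simp [Equiv.permCongrHom, hτ1]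
    · simp [Equiv.permCongrHom, hτa]
  · left
    push Not at hprim
    obtain ⟨H, hH, hbot, htop⟩ := hprim
    refine ⟨e '' H, fun σ hσ => ?_, ?_, ?_⟩
    · have hσe : σ '' (e '' H) = e '' (e.symm.permCongr σ '' H) := by
        simp [Set.image_image]
      rw [hσe, Set.disjoint_image_iff e.injective, e.injective.image_injective.eq_iff]
      exact hH.isBlock hC (hmem σ hσ)
    · rw [Set.ncard_image_of_injective _ e.injective, Set.one_lt_ncard_iff_nontrivial,
        Set.nontrivial_coe_sort.symm]
      exact (Subgroup.nontrivial_iff_ne_bot H).2 hbot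
    · rw [Set.ncard_image_of_injective _ e.injective, ← hcard, ← Set.ncard_univ]
      refine Set.ncard_lt_ncard ?_
      rw [Set.ssubset_univ_iff]
      exact fun h => htop (Subgroup.coe_eq_univ.1 h)
end

section
/- For every composite natural number d (d ≥ 4 and d not prime), the cyclic group ℤ/dℤ is a B-group. -/
/-- A finite group `K` is a B-group if every permutation group on a finite set
containing a regular subgroup isomorphic to `K` is either imprimitive or
2-transitive. -/
def IsBGroup (K : Type) [Group K] : Prop :=
  ∀ (X : Type) [Fintype X], ∀ G : Subgroup (Equiv.Perm X),
    (∃ K' : Subgroup (Equiv.Perm X), K' ≤ G ∧ IsRegularPermSubgroup K' ∧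
        Nonempty (K' ≃* K)) →
    IsImprimitivePermGroup G ∨ IsTwoTransitivePermGroup G

section StabilizerInvariant

variable {A β : Type*} [AddCommGroup A] {G : Subgroup (Equiv.Perm A)}

/-- A function on `A` is stabilizer-invariant for a permutation group `G` on `A` if it is constant
on the orbits of the stabilizer of `0` in `G`. -/
def StabInvariant (G : Subgroup (Equiv.Perm A)) (f : A → β) : Prop :=
  ∀ σ ∈ G, σ 0 = 0 → ∀ x, f (σ x) = f x

theorem StabInvariant.apply_sub (hG : ∀ a, Equiv.addRight a ∈ G) {f : A → β}
    (hf : StabInvariant G f) {σ : Equiv.Perm A} (hσ : σ ∈ G) (u v : A) :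
    f (σ v - σ u) = f (v - u) := by
  have h := hf (Equiv.addRight (-σ u) * σ * Equiv.addRight u)
    (G.mul_mem (G.mul_mem (hG _) hσ) (hG _)) (by simp) (v - u)
  simpa [sub_eq_add_neg] using h

theorem stabInvariant_mem_of_forall {S : Set A}
    (hS : ∀ σ ∈ G, σ 0 = 0 → ∀ x ∈ S, σ x ∈ S) : StabInvariant G (· ∈ S) := by
  intro σ hσ h0 x
  refine propext ⟨fun h => ?_, hS σ hσ h0 x⟩
  simpa using hS σ⁻¹ (G.inv_mem hσ) (by rw [Equiv.Perm.inv_eq_iff_eq, h0]) _ h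

theorem StabInvariant.closure (hG : ∀ a, Equiv.addRight a ∈ G) {S : Set A}
    (hS : StabInvariant G (· ∈ S)) :
    StabInvariant G (· ∈ (AddSubgroup.closure S : Set A)) := by
  refine stabInvariant_mem_of_forall fun σ hσ h0 x hx => ?_
  suffices h : ∀ y, σ (y + x) - σ y ∈ AddSubgroup.closure S by simpa [h0] using h 0
  induction hx using AddSubgroup.closure_induction with
  | mem x hx =>
    intro y
    apply AddSubgroup.subset_closure
    have := hS.apply_sub hG hσ y (y + x)
    simpa using this.mpr (by simpa using hx)
  | zero => simp
  | add x z _ _ hx hz =>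
    intro y
    have := add_mem (hz (y + x)) (hx y)
    simpa [add_assoc] using this
  | neg x _ hx =>
    intro y
    have := neg_mem (hx (y + -x))
    simpa using this

/-- The translation stabilizer of a stabilizer-invariant set is stabilizer-invariant. -/
theorem StabInvariant.translationStabilizer (hG : ∀ a, Equiv.addRight a ∈ G) {S : Set A}
    (hS : StabInvariant G (· ∈ S)) :
    StabInvariant G (· ∈ {h : A | ∀ x, x - h ∈ S ↔ x ∈ S}) := by
  refine stabInvariant_mem_of_forall fun σ hσ h0 h hh x => ?_
  obtain ⟨y, rfl⟩ := σ.surjective x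
  have h₁ : σ y - σ h ∈ S ↔ y - h ∈ S := iff_of_eq (hS.apply_sub hG hσ h y)
  have h₂ : σ y ∈ S ↔ y ∈ S := iff_of_eq (hS σ hσ h0 y)
  rw [h₁, h₂, hh y]

open Classical in
/-- The orbit of `x` under the stabilizer of `0` in `G`. -/
noncomputable def stabOrbit [Fintype A] (G : Subgroup (Equiv.Perm A)) (x : A) : Finset A :=
  Finset.univ.filter fun y => ∃ σ ∈ G, σ 0 = 0 ∧ σ x = y

theorem mem_stabOrbit [Fintype A] {x y : A} :
    y ∈ stabOrbit G x ↔ ∃ σ ∈ G, σ 0 = 0 ∧ σ x = y := by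
  simp [stabOrbit]

theorem self_mem_stabOrbit [Fintype A] (x : A) : x ∈ stabOrbit G x :=
  mem_stabOrbit.mpr ⟨1, G.one_mem, rfl, rfl⟩

theorem zero_notMem_stabOrbit [Fintype A] {x : A} (hx : x ≠ 0) : 0 ∉ stabOrbit G x := fun h => by
  obtain ⟨σ, -, hσ0, hσx⟩ := mem_stabOrbit.mp h
  exact hx (σ.injective (hσx.trans hσ0.symm))

theorem stabInvariant_mem_stabOrbit [Fintype A] (x : A) :
    StabInvariant G (· ∈ stabOrbit G x) :=
  stabInvariant_mem_of_forall (S := (stabOrbit G x : Set A)) fun τ hτ hτ0 y hy => by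
    obtain ⟨σ, hσ, hσ0, rfl⟩ := mem_stabOrbit.mp hy
    exact mem_stabOrbit.mpr ⟨τ * σ, G.mul_mem hτ hσ, by simp [hσ0, hτ0], by simp⟩

theorem StabInvariant.mul {R : Type*} [CommSemiring R] [Fintype A]
    (hG : ∀ a, Equiv.addRight a ∈ G) {f g : AddMonoidAlgebra R A}
    (hf : StabInvariant G f.coeff) (hg : StabInvariant G g.coeff) :
    StabInvariant G (f * g).coeff := by
  classical
  have key (x : A) : (f * g).coeff x = ∑ y, f.coeff y * g.coeff (x - y) := by
    simp only [AddMonoidAlgebra.coeff_mul, Finsupp.sum_fintype, zero_mul, mul_zero, ite_self,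
      Finset.sum_const_zero, implies_true]
    refine Finset.sum_congr rfl fun y _ => ?_
    simp [← eq_sub_iff_add_eq']
  intro σ hσ h0 x
  rw [key, key, ← Equiv.sum_comp σ]
  refine Finset.sum_congr rfl fun y _ => ?_
  rw [hf σ hσ h0, hg.apply_sub hG hσ]

theorem StabInvariant.pow {R : Type*} [CommSemiring R] [Fintype A]
    (hG : ∀ a, Equiv.addRight a ∈ G) {f : AddMonoidAlgebra R A}
    (hf : StabInvariant G f.coeff) (n : ℕ) : StabInvariant G (f ^ n).coeff := by
  classical
  induction n with
  | zero =>
    intro σ _ h0 x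
    have : 0 = σ x ↔ 0 = x := by
      rw [eq_comm, ← h0, σ.injective.eq_iff, h0, eq_comm]
    simp [AddMonoidAlgebra.one_def, Finsupp.single_apply, this]
  | succ n ih => rw [pow_succ]; exact ih.mul hG hf

/-- Schur's theorem on `p`-th powers in a Schur ring: modulo `p`, the number of `t ∈ T` with
`p • t = x` is stabilizer-invariant as a function of `x`. -/
theorem StabInvariant.card_nsmul_eq [Fintype A] [DecidableEq A]
    (hG : ∀ a, Equiv.addRight a ∈ G) {T : Finset A} (hT : StabInvariant G (· ∈ T))
    (p : ℕ) [Fact p.Prime] :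
    StabInvariant G fun x => ((T.filter fun t => p • t = x).card : ZMod p) := by
  let f : AddMonoidAlgebra (ZMod p) A := ∑ t ∈ T, AddMonoidAlgebra.single t 1
  have hf : StabInvariant G f.coeff := by
    intro σ hσ h0 x
    have h : σ x ∈ T ↔ x ∈ T := iff_of_eq (hT σ hσ h0 x)
    simp [f, Finsupp.finsetSum_apply, Finsupp.single_apply, h]
  have : CharP (AddMonoidAlgebra (ZMod p) A) p :=
    charP_of_injective_algebraMap (algebraMap (ZMod p) _).injective p
  have hfp : f ^ p = ∑ t ∈ T, AddMonoidAlgebra.single (p • t) 1 := by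
    simp [f, sum_pow_char]
  intro σ hσ h0 x
  have h := hf.pow hG p σ hσ h0 x
  simpa [hfp, Finsupp.finsetSum_apply, Finsupp.single_apply, Finset.sum_boole] using h

/-- The number of ways of writing `x` as a difference of elements of a stabilizer-invariant set is
stabilizer-invariant. -/
theorem StabInvariant.card_sub_mem [Fintype A] [DecidableEq A]
    (hG : ∀ a, Equiv.addRight a ∈ G) {T : Finset A} (hT : StabInvariant G (· ∈ T)) :
    StabInvariant G fun x => (T.filter fun y => y - x ∈ T).card := by
  intro σ hσ h0 x
  refine (Finset.card_equiv σ fun y => ?_).symm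
  have h₁ : σ y - σ x ∈ T ↔ y - x ∈ T := iff_of_eq (hT.apply_sub hG hσ x y)
  have h₂ : σ y ∈ T ↔ y ∈ T := iff_of_eq (hT σ hσ h0 y)
  simp [h₁, h₂]

theorem sum_card_sub_mem [Fintype A] [DecidableEq A] (T : Finset A) :
    ∑ x, (T.filter fun y => y - x ∈ T).card = T.card ^ 2 := by
  simp only [Finset.card_filter]
  rw [Finset.sum_comm, sq, ← smul_eq_mul, ← Finset.sum_const]
  refine Finset.sum_congr rfl fun y _ => ?_
  have h := (Equiv.subLeft y).sum_comp fun z => if z ∈ T then 1 else 0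
  exact h.trans (by simp)

end StabilizerInvariant

section Primitive

variable {A : Type*} [AddCommGroup A] [Fintype A] {G : Subgroup (Equiv.Perm A)}

/-- Under primitivity, a stabilizer-invariant set contains, with each of its elements outside the
`p`-torsion, the whole coset of the `p`-torsion. -/
theorem add_mem_of_stabInvariant (hG : ∀ a, Equiv.addRight a ∈ G)
    (hprim : ∀ L : AddSubgroup A, StabInvariant G (· ∈ (L : Set A)) → L = ⊥ ∨ L = ⊤)
    {p : ℕ} (hp : p.Prime) {P : AddSubgroup A} (hP : ∀ x, x ∈ P ↔ p • x = 0)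
    (hcard : Nat.card P ≤ p) (hbot : P ≠ ⊥)
    {T : Finset A} (hT : StabInvariant G (· ∈ T)) {t x : A} (ht : t ∈ T) (htP : t ∉ P)
    (hx : x ∈ P) : t + x ∈ T := by
  classical
  have := Fact.mk hp
  let R : Set A := {x | ((T.filter fun t => p • t = x).card : ZMod p) ≠ 0}
  have hR : StabInvariant G (· ∈ R) := fun σ hσ h0 x => by
    have := hT.card_nsmul_eq hG p σ hσ h0 x
    exact congrArg (· ≠ 0) this
  have hRrange : R ⊆ (nsmulAddMonoidHom p : A →+ A).range := by
    intro x hx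
    have : (T.filter fun t => p • t = x).Nonempty := by
      rw [Finset.nonempty_iff_ne_empty]
      intro h
      exact hx (by simp [h])
    obtain ⟨t, ht⟩ := this
    exact ⟨t, (Finset.mem_filter.mp ht).2⟩
  have hcl : AddSubgroup.closure R = ⊥ := by
    refine (hprim _ (hR.closure hG)).resolve_right fun h => hbot ?_
    have hrange : (nsmulAddMonoidHom p : A →+ A).range = ⊤ :=
      top_le_iff.mp (h ▸ (AddSubgroup.closure_le _).mpr hRrange)
    have hinj := Finite.injective_iff_surjective.mpr (AddMonoidHom.range_eq_top.mp hrange)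
    refine (AddSubgroup.eq_bot_iff_forall P).mpr fun x hx => hinj ?_
    simpa using (hP x).mp hx
  have hzero : p • t ∉ R := fun h => htP <| (hP t).mpr <| by
    simpa [hcl] using AddSubgroup.subset_closure h
  have hdvd : p ∣ (T.filter fun s => p • s = p • t).card := by
    simpa [R, ZMod.natCast_eq_zero_iff] using hzero
  have hle : p ≤ (T.filter fun s => p • s = p • t).card :=
    Nat.le_of_dvd (Finset.card_pos.mpr ⟨t, by simp [ht]⟩) hdvd
  let C : Finset A := Finset.univ.filter fun s => p • s = p • t
  have hC : C.card ≤ p := by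
    rw [Nat.card_eq_fintype_card, Fintype.card_subtype] at hcard
    refine le_trans (Finset.card_le_card_of_injOn (· - t) (fun s hs => ?_)
      (sub_left_injective.injOn)) hcard
    have hs : p • s = p • t := by simpa [C] using hs
    simp [hP, smul_sub, hs]
  have hsub : (T.filter fun s => p • s = p • t) ⊆ C :=
    Finset.filter_subset_filter _ (Finset.subset_univ _)
  have heq := Finset.eq_of_subset_of_card_le hsub (hC.trans hle)
  have hmem : t + x ∈ C := by simp [C, (hP x).mp hx]
  rw [← heq] at hmem
  exact (Finset.mem_filter.mp hmem).1

/-- Under primitivity, a nonempty stabilizer-invariant set that avoids `0` meets the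
`p`-torsion. -/
theorem exists_mem_torsion_of_stabInvariant (hG : ∀ a, Equiv.addRight a ∈ G)
    (hprim : ∀ L : AddSubgroup A, StabInvariant G (· ∈ (L : Set A)) → L = ⊥ ∨ L = ⊤)
    {p : ℕ} (hp : p.Prime) {P : AddSubgroup A} (hP : ∀ x, x ∈ P ↔ p • x = 0)
    (hcard : Nat.card P ≤ p) (hbot : P ≠ ⊥)
    {T : Finset A} (hT : StabInvariant G (· ∈ T)) (hne : T.Nonempty) (h0 : 0 ∉ T) :
    ∃ t ∈ T, t ∈ P := by
  by_contra! hTP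
  have hadd {t x : A} (ht : t ∈ T) (hx : x ∈ P) : t + x ∈ T :=
    add_mem_of_stabInvariant hG hprim hp hP hcard hbot hT ht (hTP t ht) hx
  let L : AddSubgroup A :=
    { carrier := {h | ∀ x, x - h ∈ (T : Set A) ↔ x ∈ (T : Set A)}
      zero_mem' := by simp
      add_mem' := fun {a b} ha hb x => by rw [← sub_sub, hb, ha]
      neg_mem' := fun {a} ha x => by rw [← ha (x - -a)]; simp }
  have hPL : P ≤ L := fun h hh x =>
    ⟨fun hx => by simpa using hadd hx hh, fun hx => by
      simpa [sub_eq_add_neg] using hadd hx (neg_mem hh)⟩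
  rcases hprim L (StabInvariant.translationStabilizer hG (S := (T : Set A)) hT) with h | h
  · exact hbot (le_bot_iff.mp (h ▸ hPL))
  · obtain ⟨t, ht⟩ := hne
    have htL : t ∈ L := h ▸ AddSubgroup.mem_top t
    exact h0 (by simpa using (htL t).mpr ht)

/-- Under primitivity, a nonempty stabilizer-invariant set that avoids `0` has at least half as
many elements as `A`. -/
theorem card_le_two_mul_card_of_stabInvariant (hG : ∀ a, Equiv.addRight a ∈ G)
    (hprim : ∀ L : AddSubgroup A, StabInvariant G (· ∈ (L : Set A)) → L = ⊥ ∨ L = ⊤)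
    {p : ℕ} (hp : p.Prime) {P : AddSubgroup A} (hP : ∀ x, x ∈ P ↔ p • x = 0)
    (hcard : Nat.card P ≤ p) (hbot : P ≠ ⊥) (htop : P ≠ ⊤)
    {T : Finset A} (hT : StabInvariant G (· ∈ T)) (hne : T.Nonempty) (h0 : 0 ∉ T) :
    Fintype.card A ≤ 2 * T.card := by
  classical
  by_contra! hlt
  have hadd {t x : A} (ht : t ∈ T) (htP : t ∉ P) (hx : x ∈ P) : t + x ∈ T :=
    add_mem_of_stabInvariant hG hprim hp hP hcard hbot hT ht htP hx
  let Q : Finset A := Finset.univ.filter (· ∈ P)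
  let a := (T.filter (· ∈ P)).card
  let b := (T.filter (· ∉ P)).card
  have hab : a + b = T.card := Finset.card_filter_add_card_filter_not _
  have haQ : a < Q.card := by
    refine Finset.card_lt_card (Finset.ssubset_iff_subset_ne.mpr ⟨?_, fun h => h0 ?_⟩)
    · exact Finset.filter_subset_filter _ (Finset.subset_univ _)
    · have : (0 : A) ∈ Q := by simp [Q, zero_mem]
      rw [← h] at this
      exact (Finset.mem_filter.mp this).1
  have hbQ : Q.card ≤ b := by
    obtain ⟨t, ht, htP⟩ : ∃ t ∈ T, t ∉ P := by
      by_contra! hTP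
      obtain ⟨t, ht⟩ := hne
      rcases hprim _ (StabInvariant.closure hG (S := (T : Set A)) hT) with h | h
      · have : t ∈ AddSubgroup.closure (T : Set A) := AddSubgroup.subset_closure ht
        rw [h, AddSubgroup.mem_bot] at this
        exact h0 (this ▸ ht)
      · exact htop (top_le_iff.mp (h ▸ (AddSubgroup.closure_le P).mpr hTP))
    refine Finset.card_le_card_of_injOn (t + ·) (fun x hx => ?_)
      ((add_right_injective t).injOn)
    have hx : x ∈ P := by simpa [Q] using hx
    simp [hadd ht htP hx, P.add_mem_cancel_right hx, htP]
  have hcount (x : A) : b ≤ (T.filter fun y => y - x ∈ T).card := by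
    obtain ⟨y, hy, hyx⟩ : ∃ y ∈ P, (T.filter fun z => z - y ∈ T).card =
        (T.filter fun z => z - x ∈ T).card := by
      by_cases hx0 : x = 0
      · exact ⟨x, hx0 ▸ zero_mem P, rfl⟩
      obtain ⟨y, hyO, hyP⟩ := exists_mem_torsion_of_stabInvariant hG hprim hp hP hcard hbot
        (stabInvariant_mem_stabOrbit x) ⟨x, self_mem_stabOrbit x⟩ (zero_notMem_stabOrbit hx0)
      obtain ⟨σ, hσ, hσ0, rfl⟩ := mem_stabOrbit.mp hyO
      exact ⟨_, hyP, hT.card_sub_mem hG σ hσ hσ0 x⟩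
    rw [← hyx]
    refine Finset.card_le_card fun z hz => ?_
    obtain ⟨hzT, hzP⟩ := Finset.mem_filter.mp hz
    exact Finset.mem_filter.mpr ⟨hzT, by simpa [sub_eq_add_neg] using hadd hzT hzP (neg_mem hy)⟩
  have hsum : T.card + (Fintype.card A - 1) * b ≤ T.card ^ 2 := by
    rw [← sum_card_sub_mem T, ← Finset.add_sum_erase _ _ (Finset.mem_univ (0 : A))]
    refine add_le_add (by simp) ?_
    rw [← Finset.card_univ, ← Finset.card_erase_of_mem (Finset.mem_univ (0 : A)), ← smul_eq_mul]
    exact Finset.card_nsmul_le_sum _ _ _ fun x _ => hcount x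
  obtain ⟨m, hm⟩ : ∃ m, Fintype.card A = m + 1 :=
    ⟨_, (Nat.succ_pred_eq_of_pos Fintype.card_pos).symm⟩
  rw [hm, ← hab] at hlt hsum
  simp only [Nat.add_sub_cancel] at hsum
  have : a < b := haQ.trans_le hbQ
  nlinarith

/-- A primitive permutation group on `A` containing the translations has a stabilizer of `0` that
is transitive on the nonzero elements, provided that the `p`-torsion of `A` is nontrivial, proper
and has at most `p` elements for some prime `p`. -/
theorem exists_stab_apply_eq (hG : ∀ a, Equiv.addRight a ∈ G)
    (hprim : ∀ L : AddSubgroup A, StabInvariant G (· ∈ (L : Set A)) → L = ⊥ ∨ L = ⊤)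
    {p : ℕ} (hp : p.Prime) {P : AddSubgroup A} (hP : ∀ x, x ∈ P ↔ p • x = 0)
    (hcard : Nat.card P ≤ p) (hbot : P ≠ ⊥) (htop : P ≠ ⊤) {u v : A} (hu : u ≠ 0) (hv : v ≠ 0) :
    ∃ σ ∈ G, σ 0 = 0 ∧ σ u = v := by
  classical
  by_contra huv
  have hhalf {x : A} (hx : x ≠ 0) : Fintype.card A ≤ 2 * (stabOrbit G x).card :=
    card_le_two_mul_card_of_stabInvariant hG hprim hp hP hcard hbot htop
      (stabInvariant_mem_stabOrbit x) ⟨x, self_mem_stabOrbit x⟩ (zero_notMem_stabOrbit hx)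
  have hdisj : Disjoint (stabOrbit G u) (stabOrbit G v) := by
    refine Finset.disjoint_left.mpr fun y hyu hyv => huv ?_
    obtain ⟨σ, hσ, hσ0, hσu⟩ := mem_stabOrbit.mp hyu
    obtain ⟨τ, hτ, hτ0, hτv⟩ := mem_stabOrbit.mp hyv
    exact ⟨τ⁻¹ * σ, G.mul_mem (G.inv_mem hτ) hσ,
      by rw [Equiv.Perm.mul_apply, hσ0, Equiv.Perm.inv_eq_iff_eq, hτ0],
      by rw [Equiv.Perm.mul_apply, hσu, Equiv.Perm.inv_eq_iff_eq, hτv]⟩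
  have hlt : (stabOrbit G u ∪ stabOrbit G v).card < Fintype.card A :=
    Finset.card_lt_univ_of_notMem (x := 0) <| by
      simp [zero_notMem_stabOrbit hu, zero_notMem_stabOrbit hv]
  rw [Finset.card_union_of_disjoint hdisj] at hlt
  have := hhalf hu
  have := hhalf hv
  omega

end Primitive

/-- A parametrization of `X` by an abelian group `A` that turns the translations of `A` into
elements of a primitive group `G` leaves no nontrivial stabilizer-invariant subgroup of `A`. -/
theorem eq_bot_or_eq_top_of_not_isImprimitive {X : Type} [Fintype X] {A : Type*} [AddCommGroup A]
    [Fintype A] {G : Subgroup (Equiv.Perm X)} (e : A ≃ X)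
    (hG : ∀ a, Equiv.addRight a ∈ G.comap e.permCongrHom.toMonoidHom)
    (himp : ¬ IsImprimitivePermGroup G) (L : AddSubgroup A)
    (hL : StabInvariant (G.comap e.permCongrHom.toMonoidHom) (· ∈ (L : Set A))) :
    L = ⊥ ∨ L = ⊤ := by
  by_contra! hne
  refine himp ⟨e '' L, fun σ hσ => ?_, ?_, ?_⟩
  · obtain ⟨τ, rfl⟩ := e.permCongrHom.surjective σ
    have hτ : τ ∈ G.comap e.permCongrHom.toMonoidHom := hσ
    have himage : ⇑(e.permCongrHom τ) '' (e '' L) = e '' (τ '' L) := by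
      simp [Set.image_image]
    have hdiff (x : A) : τ x - τ 0 ∈ L ↔ x ∈ L := by
      simpa using hL.apply_sub hG hτ 0 x
    rw [himage, Set.disjoint_image_iff e.injective, e.injective.image_injective.eq_iff]
    refine or_iff_not_imp_right.mpr fun h => ?_
    obtain ⟨_, ⟨x, hx, rfl⟩, hτx⟩ := Set.not_disjoint_iff.mp h
    have h0 : τ 0 ∈ L := by simpa using sub_mem hτx ((hdiff x).mpr hx)
    have hmem (y : A) : τ y ∈ L ↔ y ∈ L := by
      rw [← hdiff y, sub_eq_add_neg, L.add_mem_cancel_right (neg_mem h0)]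
    ext y
    obtain ⟨z, rfl⟩ := τ.surjective y
    simp [hmem]
  · rw [Set.ncard_image_of_injective _ e.injective]
    exact (AddSubgroup.one_lt_card_iff_ne_bot L).mpr hne.1
  · rw [Set.ncard_image_of_injective _ e.injective, ← Fintype.card_congr e,
      ← Nat.card_eq_fintype_card]
    exact lt_of_le_of_ne L.card_le_card_addGroup fun h => hne.2 (L.eq_top_of_card_eq h)

/-- A permutation group is 2-transitive if, after a parametrization by an abelian group `A`, it
contains the translations and its stabilizer of `0` is transitive on nonzero elements. -/
theorem isTwoTransitive_of_exists_stab_apply_eq {X : Type} {A : Type*} [AddCommGroup A]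
    {G : Subgroup (Equiv.Perm X)} (e : A ≃ X)
    (hG : ∀ a, Equiv.addRight a ∈ G.comap e.permCongrHom.toMonoidHom)
    (h : ∀ u v : A, u ≠ 0 → v ≠ 0 →
      ∃ σ ∈ G.comap e.permCongrHom.toMonoidHom, σ 0 = 0 ∧ σ u = v) :
    IsTwoTransitivePermGroup G := by
  intro x₁ x₂ y₁ y₂ hx hy
  obtain ⟨a₁, rfl⟩ := e.surjective x₁
  obtain ⟨a₂, rfl⟩ := e.surjective x₂
  obtain ⟨b₁, rfl⟩ := e.surjective y₁
  obtain ⟨b₂, rfl⟩ := e.surjective y₂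
  obtain ⟨σ, hσ, hσ0, hσa⟩ := h (a₂ - a₁) (b₂ - b₁)
    (sub_ne_zero.mpr fun h => hx (h ▸ rfl)) (sub_ne_zero.mpr fun h => hy (h ▸ rfl))
  have hmem := mul_mem (mul_mem (hG b₁) hσ) (hG (-a₁))
  exact ⟨_, hmem, by simp [hσ0], by simp [← sub_eq_add_neg, hσa]⟩

/-- A regular permutation group isomorphic to an abelian group `A` identifies the underlying set
with `A` in such a way that the group acts by translations. -/
theorem exists_equiv_addRight_mem {X : Type} [Nonempty X] {A : Type*} [AddCommGroup A]
    {K : Subgroup (Equiv.Perm X)} (hK : IsRegularPermSubgroup K) (φ : K ≃* Multiplicative A) :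
    ∃ e : A ≃ X, ∀ a, e.permCongrHom (Equiv.addRight a) ∈ K := by
  obtain ⟨x₀⟩ := ‹Nonempty X›
  let f (a : A) : X := (φ.symm (Multiplicative.ofAdd a) : Equiv.Perm X) x₀
  have hf : Function.Bijective f := by
    refine ⟨fun a b hab => ?_, fun x => ?_⟩
    · have h := hK.2 _ (mul_mem (inv_mem (φ.symm (Multiplicative.ofAdd b)).2)
        (φ.symm (Multiplicative.ofAdd a)).2) x₀
        (by rw [Equiv.Perm.mul_apply, Equiv.Perm.inv_eq_iff_eq]; exact hab)
      have h' := inv_mul_eq_one.mp h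
      simpa using h'.symm
    · obtain ⟨σ, hσ, hσx⟩ := hK.1 x₀ x
      exact ⟨(φ ⟨σ, hσ⟩).toAdd, by simpa [f] using hσx⟩
  refine ⟨Equiv.ofBijective f hf, fun a => ?_⟩
  convert (φ.symm (Multiplicative.ofAdd a)).2 using 1
  ext x
  obtain ⟨b, rfl⟩ := (Equiv.ofBijective f hf).surjective x
  simp [f, add_comm b a]

theorem cyclic_of_composite_order_isBGroup
    (d : ℕ) (hd : 4 ≤ d) (hdnp : ¬ d.Prime) :
    IsBGroup (Multiplicative (ZMod d)) := by
  have : NeZero d := ⟨by omega⟩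
  intro X _ G ⟨K, hKG, hK, ⟨φ⟩⟩
  rcases isEmpty_or_nonempty X with hX | hX
  · exact Or.inr fun x => isEmptyElim x
  refine or_iff_not_imp_left.mpr fun himp => ?_
  obtain ⟨e, he⟩ := exists_equiv_addRight_mem hK φ
  have hG (a : ZMod d) : Equiv.addRight a ∈ G.comap e.permCongrHom.toMonoidHom := hKG (he a)
  have hp : d.minFac.Prime := Nat.minFac_prime (by omega)
  have := Fact.mk hp
  let P : AddSubgroup (ZMod d) := (nsmulAddMonoidHom d.minFac : ZMod d →+ ZMod d).ker
  have hP (x : ZMod d) : x ∈ P ↔ d.minFac • x = 0 := by simp [P]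
  have hcard : Nat.card P ≤ d.minFac := by
    rw [Nat.card_eq_fintype_card, Fintype.card_subtype]
    simpa [hP] using IsAddCyclic.card_nsmul_eq_zero_le (α := ZMod d) hp.pos
  have hbot : P ≠ ⊥ := fun h => by
    obtain ⟨x, hx⟩ := exists_prime_addOrderOf_dvd_card (G := ZMod d) d.minFac
      (by simpa using d.minFac_dvd)
    have hxP : x ∈ P := (hP x).mpr (hx ▸ addOrderOf_nsmul_eq_zero x)
    rw [h, AddSubgroup.mem_bot] at hxP
    simp [hxP] at hx
    exact hp.one_lt.ne hx
  have htop : P ≠ ⊤ := fun h => by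
    have h1 := (hP 1).mp (h ▸ AddSubgroup.mem_top 1)
    have hdvd : d ∣ d.minFac := by
      simpa [nsmul_eq_mul, ZMod.natCast_eq_zero_iff] using h1
    exact hdnp (Nat.dvd_antisymm hdvd d.minFac_dvd ▸ hp)
  exact isTwoTransitive_of_exists_stab_apply_eq e hG fun u v hu hv =>
    exists_stab_apply_eq hG (eq_bot_or_eq_top_of_not_isImprimitive e hG himp) hp hP hcard hbot htop
      hu hv
end

section
/- In the setting below, suppose p is a prime dividing d and there is a G-irreducible G-invariant subspace W of M with basis {v_j : j ∈ B} for some B ⊆ {1, …, d−1} (so 0 ∉ B) such that p divides every j ∈ B. Then there exists a normal subgroup N of G with g^{d/p} ∈ N such that N is nontrivial, N is not transitive on ℤ/dℤ, and every orbit of N on ℤ/dℤ is a block for G; in particular G is imprimitive. -/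
/-- The vector `v_j = ∑_i ζ^{-ij} e_i` in `M = (ZMod d → ℂ)`, recorded by its
coordinates: `v_j (i) = ζ^{-ij}`. -/
noncomputable def cycVec (d : ℕ) (ζ : ℂ) (j : ℕ) : ZMod d → ℂ :=
  fun i => ζ ^ (-((i.val * j : ℕ) : ℤ))

/-- The right action of a permutation `σ` on `M = (ZMod d → ℂ)`, determined by
`e_i · σ = e_{σ i}` on the standard basis. -/
def permAct (d : ℕ) (σ : Equiv.Perm (ZMod d)) (f : ZMod d → ℂ) : ZMod d → ℂ :=
  fun x => f (σ.symm x)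

/-- A subset `B'` of `ZMod d` is a block for `G`. -/
def IsBlockFor (d : ℕ) (G : Subgroup (Equiv.Perm (ZMod d))) (B' : Set (ZMod d)) : Prop :=
  ∀ σ ∈ G, ⇑σ '' B' = B' ∨ Disjoint (⇑σ '' B') B'

theorem addRight_one_pow_apply (d n : ℕ) (x : ZMod d) :
    ((Equiv.addRight (1 : ZMod d)) ^ n) x = x + n := by
  induction n with
  | zero => simp
  | succ n ih => rw [pow_succ', Equiv.Perm.mul_apply, ih]; simp [add_assoc]

theorem cycVec_add_natCast {d : ℕ} [NeZero d] {ζ : ℂ} (hζ : IsPrimitiveRoot ζ d) {n j : ℕ}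
    (h : d ∣ n * j) (x : ZMod d) : cycVec d ζ j (x + n) = cycVec d ζ j x := by
  simp only [cycVec, zpow_neg, zpow_natCast]
  rw [inv_inj]
  refine pow_eq_pow_of_modEq ((ZMod.natCast_eq_natCast_iff _ _ _).1 ?_) hζ.pow_eq_one
  have h0 : ((n * j : ℕ) : ZMod d) = 0 := (ZMod.natCast_eq_zero_iff _ _).2 h
  push_cast at h0 ⊢
  simp only [ZMod.natCast_val, ZMod.cast_id', id_eq]
  rw [add_mul, h0, add_zero]

theorem cycVec_zero_ne_one {d : ℕ} (hd : 2 ≤ d) {ζ : ℂ} (hζ : IsPrimitiveRoot ζ d) {j : ℕ}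
    (hj : j ∈ Finset.Icc 1 (d - 1)) : cycVec d ζ j 0 ≠ cycVec d ζ j 1 := by
  rw [Finset.mem_Icc] at hj
  have : Fact (1 < d) := ⟨hd⟩
  have hne : ζ ^ j ≠ 1 := hζ.pow_ne_one_of_pos_of_lt (by omega) (by omega)
  simpa [cycVec, ZMod.val_one, eq_comm] using hne

/-- The elements of `G` fixing every function in `W`. -/
def pointwiseStabilizer {α : Type*} (G : Subgroup (Equiv.Perm α)) (W : Set (α → ℂ)) :
    Subgroup (Equiv.Perm α) where
  carrier := {σ | σ ∈ G ∧ ∀ f ∈ W, ∀ x, f (σ x) = f x}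
  one_mem' := ⟨G.one_mem, fun _ _ _ => rfl⟩
  mul_mem' := fun ⟨ha, ha'⟩ ⟨hb, hb'⟩ =>
    ⟨G.mul_mem ha hb, fun f hf x => by rw [Equiv.Perm.mul_apply, ha' f hf, hb' f hf]⟩
  inv_mem' := fun {a} ⟨ha, ha'⟩ =>
    ⟨G.inv_mem ha, fun f hf x => by
      have := ha' f hf (a⁻¹ x)
      rw [← Equiv.Perm.mul_apply, mul_inv_cancel, Equiv.Perm.one_apply] at this
      exact this.symm⟩

theorem isBlockFor_orbit_of_normal {d : ℕ} {G N : Subgroup (Equiv.Perm (ZMod d))}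
    (hN : ∀ σ ∈ G, ∀ τ ∈ N, σ * τ * σ⁻¹ ∈ N) (x : ZMod d) :
    IsBlockFor d G {y | ∃ τ ∈ N, τ x = y} := by
  intro σ hσ
  rw [or_iff_not_imp_right, Set.not_disjoint_iff]
  rintro ⟨_, ⟨_, ⟨τ, hτ, rfl⟩, rfl⟩, ρ, hρ, hx⟩
  have hconj : ∀ τ' ∈ N, σ⁻¹ * τ' * σ ∈ N := fun τ' hτ' => by
    simpa using hN σ⁻¹ (G.inv_mem hσ) τ' hτ'
  have key : σ x = ((σ * τ⁻¹ * σ⁻¹) * ρ) x := by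
    simp [hx]
  have key_mem := N.mul_mem (hN σ hσ τ⁻¹ (N.inv_mem hτ)) hρ
  generalize (σ * τ⁻¹ * σ⁻¹) * ρ = κ at key key_mem
  ext y
  constructor
  · rintro ⟨_, ⟨τ', hτ', rfl⟩, rfl⟩
    refine ⟨(σ * τ' * σ⁻¹) * κ, N.mul_mem (hN σ hσ τ' hτ') key_mem, ?_⟩
    simp [← key]
  · rintro ⟨τ', hτ', rfl⟩
    refine ⟨_, ⟨_, hconj _ (N.mul_mem hτ' (N.inv_mem key_mem)), rfl⟩, ?_⟩
    simp [key]

theorem imprimitive_of_basis_set_divisible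
    (d : ℕ) [NeZero d] (hd : 2 ≤ d)
    (G : Subgroup (Equiv.Perm (ZMod d)))
    (hg : Equiv.addRight (1 : ZMod d) ∈ G)
    (htrans : ∀ x y : ZMod d, ∃ σ ∈ G, σ x = y)
    (ζ : ℂ) (hζ : IsPrimitiveRoot ζ d)
    (p : ℕ) (hp : p.Prime) (hpd : p ∣ d)
    (W : Submodule ℂ (ZMod d → ℂ))
    -- `W` is `G`-invariant
    (hWinv : ∀ σ ∈ G, permAct d σ '' (W : Set (ZMod d → ℂ)) = (W : Set (ZMod d → ℂ)))
    -- `W` is `G`-irreducible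
    (hWne : W ≠ ⊥)
    (hWirr : ∀ W' : Submodule ℂ (ZMod d → ℂ), W' ≤ W →
      (∀ σ ∈ G, permAct d σ '' (W' : Set (ZMod d → ℂ)) = (W' : Set (ZMod d → ℂ))) →
      W' = ⊥ ∨ W' = W)
    -- `{v_j : j ∈ B}` is a basis of `W`, with `B ⊆ {1, …, d-1}`
    (B : Finset ℕ) (hB : B ⊆ Finset.Icc 1 (d - 1))
    (hli : LinearIndependent ℂ (fun j : B => cycVec d ζ (j : ℕ)))
    (hspan : Submodule.span ℂ (cycVec d ζ '' (B : Set ℕ)) = W)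
    -- `p` divides every `j ∈ B`
    (hpB : ∀ j ∈ B, p ∣ j) :
    ∃ N : Subgroup (Equiv.Perm (ZMod d)),
      N ≤ G ∧
      (∀ σ ∈ G, ∀ τ ∈ N, σ * τ * σ⁻¹ ∈ N) ∧
      (Equiv.addRight (1 : ZMod d)) ^ (d / p) ∈ N ∧
      N ≠ ⊥ ∧
      ¬ (∀ x y : ZMod d, ∃ τ ∈ N, τ x = y) ∧
      (∀ x : ZMod d, IsBlockFor d G {y | ∃ τ ∈ N, τ x = y}) ∧
      (∃ B' : Set (ZMod d), IsBlockFor d G B' ∧ 1 < B'.ncard ∧ B'.ncard < d) := by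
  have hpos : 0 < d := by omega
  have hq : 0 < d / p := Nat.div_pos (Nat.le_of_dvd hpos hpd) hp.pos
  have hqd : d / p < d := Nat.div_lt_self hpos hp.one_lt
  have hgN : (Equiv.addRight (1 : ZMod d)) ^ (d / p) ∈
      pointwiseStabilizer G (W : Set (ZMod d → ℂ)) := by
    refine ⟨G.pow_mem hg _, fun f hf x => ?_⟩
    rw [addRight_one_pow_apply]
    rw [SetLike.mem_coe, ← hspan] at hf
    induction hf using Submodule.span_induction with
    | mem f hf =>
      obtain ⟨j, hj, rfl⟩ := hf
      refine cycVec_add_natCast hζ ?_ x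
      calc d = d / p * p := (Nat.div_mul_cancel hpd).symm
        _ ∣ d / p * j := Nat.mul_dvd_mul_left _ (hpB j hj)
    | zero => rfl
    | add f g _ _ ihf ihg => simp only [Pi.add_apply, ihf, ihg]
    | smul c f _ ih => simp only [Pi.smul_apply, ih]
  have hnormal : ∀ σ ∈ G, ∀ τ ∈ pointwiseStabilizer G (W : Set (ZMod d → ℂ)),
      σ * τ * σ⁻¹ ∈ pointwiseStabilizer G (W : Set (ZMod d → ℂ)) := by
    rintro σ hσ τ ⟨hτ, hfix⟩
    refine ⟨G.mul_mem (G.mul_mem hσ hτ) (G.inv_mem hσ), fun f hf x => ?_⟩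
    have hmem : permAct d σ⁻¹ f ∈ (W : Set (ZMod d → ℂ)) :=
      hWinv σ⁻¹ (G.inv_mem hσ) ▸ Set.mem_image_of_mem _ hf
    have := hfix _ hmem (σ⁻¹ x)
    change f (σ (τ (σ⁻¹ x))) = f (σ (σ⁻¹ x)) at this
    rwa [← Equiv.Perm.mul_apply σ σ⁻¹, mul_inv_cancel, Equiv.Perm.one_apply] at this
  have hBne : B.Nonempty := by
    rw [Finset.nonempty_iff_ne_empty]
    rintro rfl
    exact hWne (by simpa using hspan.symm)
  obtain ⟨j, hj⟩ := hBne
  have hjW : cycVec d ζ j ∈ W := hspan ▸ Submodule.subset_span (Set.mem_image_of_mem _ hj)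
  have h01 : ¬ ∃ τ ∈ pointwiseStabilizer G (W : Set (ZMod d → ℂ)), τ 0 = 1 := by
    rintro ⟨τ, ⟨-, hτ⟩, hτ01⟩
    exact cycVec_zero_ne_one hd hζ (hB hj) (hτ01 ▸ (hτ _ hjW 0).symm)
  have hq0 : ((d / p : ℕ) : ZMod d) ≠ 0 := by
    rw [Ne, ZMod.natCast_eq_zero_iff]
    exact Nat.not_dvd_of_pos_of_lt hq hqd
  refine ⟨pointwiseStabilizer G (W : Set (ZMod d → ℂ)), fun _ h => h.1, hnormal, hgN, ?_,
    fun h => h01 (h 0 1), isBlockFor_orbit_of_normal hnormal, _,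
    isBlockFor_orbit_of_normal hnormal 0, ?_, ?_⟩
  · intro hbot
    rw [hbot, Subgroup.mem_bot] at hgN
    have := addRight_one_pow_apply d (d / p) 0
    rw [hgN, zero_add] at this
    exact hq0 this.symm
  · refine (Set.one_lt_ncard (Set.toFinite _)).2
      ⟨0, ⟨1, one_mem _, rfl⟩, ((d / p : ℕ) : ZMod d), ⟨_, hgN, ?_⟩, hq0.symm⟩
    rw [addRight_one_pow_apply, zero_add]
  · refine lt_of_lt_of_eq ?_ ((Set.ncard_univ _).trans (Nat.card_zmod d))
    exact Set.ncard_lt_ncard ((Set.ssubset_univ_iff).2 fun h =>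
      h01 (h.symm.subset (Set.mem_univ 1)))
end

section
/- Let p be a prime and let G be a transitive subgroup of the symmetric group on a finite set X with |X| = p. Then either G is 2-transitive, or G contains a normal subgroup of order p. -/
open Polynomial in
/-- The first non-vanishing positive power sum of a set of nonzero residues has exponent at most
the size of the set. -/
theorem exists_first_powerSum_ne_zero {p : ℕ} [Fact p.Prime] {U : Finset (ZMod p)}
    (h0 : (0 : ZMod p) ∉ U) (hne : U.Nonempty) (hcard : U.card < p) :
    ∃ k, 0 < k ∧ k ≤ U.card ∧ ∑ u ∈ U, u ^ k ≠ 0 ∧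
      ∀ i, 0 < i → i < k → ∑ u ∈ U, u ^ i = 0 := by
  classical
  have hex : ∃ k, 0 < k ∧ k ≤ U.card ∧ ∑ u ∈ U, u ^ k ≠ 0 := by
    by_contra! hcon
    set f : (ZMod p)[X] := ∏ u ∈ U, (X - C u) with hf
    have hdeg : f.natDegree = U.card := natDegree_finsetProd_X_sub_C_eq_card U id
    have hsum : ∑ u ∈ U, f.eval u = 0 := by
      refine Finset.sum_eq_zero fun u hu => ?_
      rw [hf, eval_prod]
      exact Finset.prod_eq_zero hu (by simp)
    simp_rw [eval_eq_sum_range] at hsum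
    rw [Finset.sum_comm, Finset.sum_range_succ'] at hsum
    rw [Finset.sum_eq_zero] at hsum
    · have hc : (U.card : ZMod p) ≠ 0 := by
        rw [Ne, ZMod.natCast_eq_zero_iff]
        exact Nat.not_dvd_of_pos_of_lt hne.card_pos hcard
      have hf0 : f.coeff 0 ≠ 0 := by
        rw [coeff_zero_eq_eval_zero, hf, eval_prod, Finset.prod_ne_zero_iff]
        intro u hu
        have : u ≠ 0 := fun h => h0 (h ▸ hu)
        simpa using this
      simp [hc, hf0] at hsum
    · intro i hi
      rw [← Finset.mul_sum, hcon (i + 1) (by omega) (by rw [Finset.mem_range] at hi; omega),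
        mul_zero]
  refine ⟨Nat.find hex, (Nat.find_spec hex).1, (Nat.find_spec hex).2.1,
    (Nat.find_spec hex).2.2, fun i hi hik => ?_⟩
  by_contra hne'
  exact Nat.find_min hex hik ⟨hi, hik.le.trans (Nat.find_spec hex).2.1, hne'⟩

open Polynomial in
/-- Summing the translates of `Q` over `U` and subtracting `|U| • Q` lowers the degree by exactly
the exponent of the first non-vanishing power sum of `U`. -/
theorem coeff_sum_taylor_sub {R : Type*} [CommRing R] (U : Finset R) (Q : R[X]) {k : ℕ}
    (hk : 0 < k) (hkd : k ≤ Q.natDegree) (hs : ∀ i, 0 < i → i < k → ∑ u ∈ U, u ^ i = 0) :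
    (∑ u ∈ U, taylor u Q - C (U.card : R) * Q).coeff (Q.natDegree - k) =
      (Q.natDegree.choose k : R) * Q.leadingCoeff * ∑ u ∈ U, u ^ k := by
  obtain ⟨m, hm⟩ : ∃ m, Q.natDegree = m + k := ⟨Q.natDegree - k, by omega⟩
  have key : ∑ u ∈ U, (taylor u Q).coeff m =
      ∑ i ∈ Finset.range (k + 1),
        (((m + i).choose m : R) * Q.coeff (m + i)) * ∑ u ∈ U, u ^ i := by
    have (u : R) : (taylor u Q).coeff m =
        ∑ i ∈ Finset.range (k + 1), (((m + i).choose m : R) * Q.coeff (m + i)) * u ^ i := by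
      rw [taylor_coeff, hasseDeriv_apply, sum_over_range _ (by simp), eval_finsetSum, hm,
        add_assoc, Finset.sum_range_add, Finset.sum_eq_zero, zero_add]
      · simp [eval_monomial]
      · intro i hi
        rw [Nat.choose_eq_zero_of_lt (Finset.mem_range.mp hi)]
        simp
    simp_rw [this, Finset.mul_sum]
    exact Finset.sum_comm
  have hsub : Q.natDegree - k = m := by omega
  rw [hsub, coeff_sub, finsetSum_coeff, key, coeff_C_mul, Finset.sum_range_succ,
    ← Nat.succ_pred_eq_of_pos hk, Finset.sum_range_succ', Finset.sum_eq_zero,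
    Nat.succ_pred_eq_of_pos hk, leadingCoeff, hm]
  · rw [Nat.choose_symm_add (a := m) (b := k)]
    simp
    ring
  · intro i hi
    rw [Finset.mem_range, Nat.pred_eq_sub_one] at hi
    rw [hs (i + 1) (by omega) (by omega), mul_zero]

/-- A permutation compatible with differences in `U` satisfies the same power sum identities
as the identity. -/
theorem sum_perm_add_pow {R : Type*} [CommRing R] (U : Finset R) (π : Equiv.Perm R)
    (hπ : ∀ i, ∀ u ∈ U, π (i + u) - π i ∈ U) {j k : ℕ} (hj : 0 < j) (hjk : j ≤ k)
    (hs : ∀ i, 0 < i → i < k → ∑ u ∈ U, u ^ i = 0) (x : R) :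
    ∑ u ∈ U, π (x + u) ^ j - U.card * π x ^ j = if j = k then ∑ u ∈ U, u ^ k else 0 := by
  have hinj : Set.InjOn (fun u => π (x + u) - π x) U := by
    intro a _ b _ hab
    simpa using hab
  have h1 : ∑ u ∈ U, π (x + u) ^ j = ∑ v ∈ U, (v + π x) ^ j := by
    refine Finset.sum_nbij (fun u => π (x + u) - π x) (hπ x) hinj
      (Finset.surjOn_of_injOn_of_card_le _ (hπ x) hinj le_rfl) fun u _ => by simp
  simp_rw [h1, add_pow]
  rw [Finset.sum_comm, Finset.sum_range_succ, ← Nat.succ_pred_eq_of_pos hj,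
    Finset.sum_range_succ', Finset.sum_eq_zero, Nat.succ_pred_eq_of_pos hj]
  · split_ifs with h
    · subst h; simp
    · simp [hs j hj (by omega)]
  · intro i hi
    rw [Finset.mem_range, Nat.pred_eq_sub_one] at hi
    rw [← Finset.sum_mul, ← Finset.sum_mul, hs (i + 1) (by omega) (by omega)]
    simp

open Polynomial in
theorem affine_of_preserves_small_difference_set {p : ℕ} [Fact p.Prime] (U : Finset (ZMod p))
    (h0 : (0 : ZMod p) ∉ U) (hne : U.Nonempty) (hcard : 2 * U.card < p)
    (π : Equiv.Perm (ZMod p)) (hπ : ∀ i, ∀ u ∈ U, π (i + u) - π i ∈ U) :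
    ∃ a b, ∀ i, π i = a * i + b := by
  have hp : p.Prime := Fact.out
  obtain ⟨k, hk, hkU, hsk, hs⟩ := exists_first_powerSum_ne_zero h0 hne (by omega)
  obtain ⟨P, hPp, hP⟩ : ∃ P : (ZMod p)[X], P.natDegree < p ∧ ∀ x, P.eval x = π x := by
    refine ⟨Lagrange.interpolate Finset.univ id π, ?_, fun x =>
      Lagrange.eval_interpolate_at_node (v := id) π (Set.injOn_id _) (Finset.mem_univ x)⟩
    have := Lagrange.degree_interpolate_lt (s := Finset.univ) (v := id) π
      (Set.injOn_id _)
    rw [Finset.card_univ, ZMod.card] at this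
    by_cases h : Lagrange.interpolate Finset.univ id π = 0
    · simpa [h] using hp.pos
    · exact (natDegree_lt_iff_degree_lt h).mpr this
  set n := P.natDegree with hn
  have hn0 : 0 < n := by
    by_contra hn0
    rw [not_lt, nonpos_iff_eq_zero] at hn0
    have hconst := eq_C_of_natDegree_eq_zero hn0
    have h01 : π 0 = π 1 := by rw [← hP, ← hP, hconst]; simp
    exact zero_ne_one (π.injective h01)
  obtain ⟨j, hj, hjk, hknj, hnjp⟩ : ∃ j, 0 < j ∧ j ≤ k ∧ k ≤ n * j ∧ n * j < p := by
    by_cases hkn : k ≤ n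
    · exact ⟨1, one_pos, hk, by omega, by omega⟩
    · have hmod := Nat.div_add_mod (k + n - 1) n
      have hlt := Nat.mod_lt (k + n - 1) hn0
      refine ⟨(k + n - 1) / n, Nat.div_pos (by omega) hn0, ?_, by omega, by omega⟩
      refine Nat.div_le_of_le_mul ?_
      nlinarith [Nat.sub_le (k + n) 1, Nat.sub_add_cancel (show 1 ≤ k + n by omega),
        mul_nonneg (Nat.zero_le (k - 1)) (Nat.zero_le (n - 1)),
        Nat.sub_add_cancel hk, Nat.sub_add_cancel hn0]
  have hQd : (P ^ j).natDegree = n * j := by rw [natDegree_pow, mul_comm]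
  set D := ∑ u ∈ U, taylor u (P ^ j) - C (U.card : ZMod p) * P ^ j with hD
  have hDdeg : D.natDegree < p := by
    refine lt_of_le_of_lt (natDegree_sub_le_of_le (m := n * j) (n := n * j) ?_ ?_) (by simpa)
    · exact natDegree_sum_le_of_forall_le _ _ fun u _ => by rw [natDegree_taylor, hQd]
    · exact (natDegree_C_mul_le _ _).trans hQd.le
  set c : ZMod p := if j = k then ∑ u ∈ U, u ^ k else 0 with hc
  have hDC : D = C c := by
    refine eq_of_natDegree_lt_card_of_eval_eq' D (C c) Finset.univ (fun x _ => ?_) ?_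
    · rw [hD, eval_sub, eval_finsetSum, eval_C, hc, ← sum_perm_add_pow U π hπ hj hjk hs x]
      simp [taylor_eval, hP]
    · simpa [ZMod.card] using hDdeg
  have hcoeff := coeff_sum_taylor_sub U (P ^ j) hk (hQd ▸ hknj) hs
  have hP0 : P ≠ 0 := by rintro rfl; simp [hn] at hn0
  have hchoose : ((n * j).choose k : ZMod p) ≠ 0 := by
    rw [Ne, ZMod.natCast_eq_zero_iff]
    intro hdvd
    have : p ∣ (n * j).factorial := by
      rw [← Nat.choose_mul_factorial_mul_factorial hknj, mul_assoc]
      exact hdvd.mul_right _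
    exact absurd ((hp.dvd_factorial).mp this) (by omega)
  have hne0 : (C c : (ZMod p)[X]).coeff (n * j - k) ≠ 0 := by
    rw [← hDC, hD, ← hQd, hcoeff, hQd]
    exact mul_ne_zero (mul_ne_zero hchoose (leadingCoeff_ne_zero.mpr (pow_ne_zero _ hP0))) hsk
  rw [coeff_C] at hne0
  have hdk : n * j - k = 0 := by
    by_contra h; simp [h] at hne0
  have hjk' : j = k := by
    by_contra h; simp [hc, h] at hne0
  have hn1 : n = 1 := by
    subst hjk'
    exact Nat.eq_of_mul_eq_mul_right hk (by omega)
  refine ⟨P.coeff 1, P.coeff 0, fun i => ?_⟩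
  rw [← hP]
  conv_lhs => rw [eq_X_add_C_of_natDegree_le_one (hn ▸ hn1.le : P.natDegree ≤ 1)]
  simp

/-- A permutation of `ZMod p` mapping pairs with difference in a nonempty proper subset of the
nonzero residues to such pairs is affine. -/
theorem affine_of_preserves_difference_set {p : ℕ} [Fact p.Prime] (U : Finset (ZMod p))
    (h0 : (0 : ZMod p) ∉ U) (hne : U.Nonempty) (hproper : ∃ w, w ≠ 0 ∧ w ∉ U)
    (π : Equiv.Perm (ZMod p)) (hπ : ∀ i, ∀ u ∈ U, π (i + u) - π i ∈ U) :
    ∃ a b, ∀ i, π i = a * i + b := by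
  by_cases hcard : 2 * U.card < p
  · exact affine_of_preserves_small_difference_set U h0 hne hcard π hπ
  obtain ⟨w, hw0, hwU⟩ := hproper
  have hV (v : ZMod p) : v ∈ (insert 0 U)ᶜ ↔ v ≠ 0 ∧ v ∉ U := by simp
  refine affine_of_preserves_small_difference_set (insert 0 U)ᶜ (by simp) ⟨w, by simp [hw0, hwU]⟩
    ?_ π fun i v hv => ?_
  · rw [Finset.card_compl, Finset.card_insert_of_notMem h0, ZMod.card]
    have : p.Prime := Fact.out
    have := this.pos
    omega
  · rw [hV] at hv ⊢
    refine ⟨by simpa [sub_eq_zero] using hv.1, fun hmem => hv.2 ?_⟩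
    have hinj : Set.InjOn (fun u => π (i + u) - π i) U := by
      intro a _ b _ hab
      simpa using hab
    obtain ⟨u, hu, huv⟩ := Finset.surjOn_of_injOn_of_card_le _ (hπ i) hinj le_rfl hmem
    have : u = v := by simpa using huv
    exact this ▸ hu

/-- A transitive group of prime degree `p` contains an element acting as a `p`-cycle. -/
theorem exists_regular_cycle {p : ℕ} (hp : p.Prime) {X : Type} [Fintype X]
    (hX : Fintype.card X = p) (G : Subgroup (Equiv.Perm X)) (hG : IsTransitivePermGroup G) :
    ∃ g : G, orderOf g = p ∧
      ∃ e : ZMod p ≃ X, ∀ (i : ZMod p) (n : ℕ), e (i + n) = ((g : Equiv.Perm X) ^ n) (e i) := by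
  classical
  have : Fact p.Prime := ⟨hp⟩
  have : MulAction.IsPretransitive G X :=
    ⟨fun x y => let ⟨σ, hσ, h⟩ := hG x y; ⟨⟨σ, hσ⟩, h⟩⟩
  have : Nonempty X := Fintype.card_pos_iff.mp (hX ▸ hp.pos)
  have hdvd : p ∣ Nat.card G := by
    rw [← hX, ← Nat.card_eq_fintype_card,
      ← MulAction.index_stabilizer_of_transitive G (Classical.arbitrary X)]
    exact Subgroup.index_dvd_card _
  obtain ⟨g, hg⟩ := exists_prime_orderOf_dvd_card' p hdvd
  have hg' : orderOf (g : Equiv.Perm X) = p := by rw [Subgroup.orderOf_coe, hg]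
  refine ⟨g, hg, ?_⟩
  obtain ⟨x, hx⟩ : ∃ x, (g : Equiv.Perm X) x ≠ x := by
    by_contra! h
    have : (g : Equiv.Perm X) = 1 := Equiv.ext h
    rw [this, orderOf_one] at hg'
    exact hp.one_lt.ne hg'
  have hper : Function.minimalPeriod (g : Equiv.Perm X) x = p := by
    have hpt : Function.IsPeriodicPt (g : Equiv.Perm X) p x := by
      rw [Function.IsPeriodicPt, Function.IsFixedPt, ← Equiv.Perm.coe_pow, ← hg', pow_orderOf_eq_one]
      rfl
    refine ((Nat.dvd_prime hp).mp hpt.minimalPeriod_dvd).resolve_left fun h => hx ?_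
    exact Function.minimalPeriod_eq_one_iff_isFixedPt.mp h
  have hinj : Function.Injective fun i : ZMod p => ((g : Equiv.Perm X) ^ i.val) x := by
    intro i j hij
    refine ZMod.val_injective p (Function.iterate_injOn_Iio_minimalPeriod
      (f := (g : Equiv.Perm X)) (x := x) ?_ ?_ (by simpa [Equiv.Perm.coe_pow] using hij))
    · simpa [hper] using i.val_lt
    · simpa [hper] using j.val_lt
  refine ⟨Equiv.ofBijective _ ((Fintype.bijective_iff_injective_and_card _).mpr
    ⟨hinj, by rw [ZMod.card, hX]⟩), fun i n => ?_⟩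
  simp only [Equiv.ofBijective_apply]
  rw [← Equiv.Perm.mul_apply, ← pow_add, ← pow_mod_orderOf (g : Equiv.Perm X) (n + i.val), hg',
    ZMod.val_add, ZMod.val_natCast, Nat.add_mod_mod, add_comm]

theorem burnside_prime_degree
    (p : ℕ) (hp : p.Prime)
    (X : Type) [Fintype X] (hX : Fintype.card X = p)
    (G : Subgroup (Equiv.Perm X)) (hG : IsTransitivePermGroup G) :
    IsTwoTransitivePermGroup G ∨ ∃ N : Subgroup G, N.Normal ∧ Nat.card N = p := by
  classical
  have : Fact p.Prime := ⟨hp⟩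
  obtain ⟨g, hg, e, he⟩ := exists_regular_cycle hp hX G hG
  refine or_iff_not_imp_left.mpr fun h2 => ?_
  simp only [IsTwoTransitivePermGroup] at h2
  push Not at h2
  obtain ⟨x₁, x₂, y₁, y₂, hx, hy, hno⟩ := h2
  let r (i j : ZMod p) : Prop := ∃ σ ∈ G, σ x₁ = e i ∧ σ x₂ = e j
  have hr_shift (i j c : ZMod p) (h : r i j) : r (i + c) (j + c) := by
    obtain ⟨σ, hσ, h1, h2⟩ := h
    have hc : ((c.val : ℕ) : ZMod p) = c := ZMod.natCast_zmod_val c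
    refine ⟨(g : Equiv.Perm X) ^ c.val * σ, G.mul_mem (G.pow_mem g.2 _) hσ, ?_, ?_⟩
    · rw [Equiv.Perm.mul_apply, h1, ← he, hc]
    · rw [Equiv.Perm.mul_apply, h2, ← he, hc]
  have haffine (τ : Equiv.Perm X) (hτ : τ ∈ G) : ∃ a b, ∀ i, τ (e i) = e (a * i + b) := by
    let π : Equiv.Perm (ZMod p) := (e.trans τ).trans e.symm
    have hπe (i : ZMod p) : e (π i) = τ (e i) := by simp [π]
    suffices h : ∃ a b, ∀ i, π i = a * i + b by
      obtain ⟨a, b, hab⟩ := h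
      exact ⟨a, b, fun i => by rw [← hab, hπe]⟩
    refine affine_of_preserves_difference_set
      (Finset.univ.filter fun u => r 0 u) ?_ ?_ ?_ π ?_
    · rw [Finset.mem_filter]
      rintro ⟨-, σ, -, h1, h2⟩
      exact hx (σ.injective (h1.trans h2.symm))
    · obtain ⟨σ, hσ, h⟩ := hG x₁ (e 0)
      exact ⟨e.symm (σ x₂), by simpa using ⟨σ, hσ, h, by simp⟩⟩
    · refine ⟨e.symm y₂ - e.symm y₁, by simpa [sub_eq_zero] using hy.symm, fun h => ?_⟩
      obtain ⟨σ, hσ, h1, h2⟩ := hr_shift _ _ (e.symm y₁) (Finset.mem_filter.mp h).2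
      exact hno σ hσ (by simpa using h1) (by simpa using h2)
    · intro i u hu
      obtain ⟨σ, hσ, h1, h2⟩ := hr_shift _ _ i (Finset.mem_filter.mp hu).2
      have hτr : r (π i) (π (i + u)) := by
        refine ⟨τ * σ, G.mul_mem hτ hσ, ?_, ?_⟩
        · rw [Equiv.Perm.mul_apply, h1, hπe, zero_add]
        · rw [Equiv.Perm.mul_apply, h2, hπe, add_comm]
      have := hr_shift _ _ (-π i) hτr
      rw [add_neg_cancel, ← sub_eq_add_neg] at this
      simpa using this
  refine ⟨Subgroup.zpowers g, ?_, by rw [Nat.card_zpowers, hg]⟩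
  suffices h : ∀ τ : G, τ * g * τ⁻¹ ∈ Subgroup.zpowers g by
    refine ⟨fun n hn τ => ?_⟩
    obtain ⟨m, rfl⟩ := Subgroup.mem_zpowers_iff.mp hn
    rw [← conj_zpow]
    exact Subgroup.zpow_mem _ (h τ) m
  intro τ
  obtain ⟨a, b, hab⟩ := haffine τ τ.2
  refine Subgroup.mem_zpowers_iff.mpr ⟨a.val, ?_⟩
  rw [zpow_natCast, eq_mul_inv_iff_mul_eq]
  ext x
  obtain ⟨i, rfl⟩ := e.surjective x
  have hstep := he i 1
  rw [pow_one, Nat.cast_one] at hstep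
  simp only [Subgroup.coe_mul, Subgroup.coe_pow, Equiv.Perm.mul_apply]
  rw [hab, ← he, ← hstep, hab, ZMod.natCast_zmod_val]
  congr 1
  ring
end

section
/- Let p be a prime, n ≥ 1, and V = (ℤ/pℤ)^n. Let AGL(V) be the group of permutations of V of the form x ↦ A·x + b with A ∈ GL(V) and b ∈ V. Suppose K is an abelian subgroup of AGL(V) acting regularly on V. If n < p, then every element of K has order dividing p; that is, K is elementary abelian, isomorphic to (ℤ/pℤ)^n. -/
/-- A permutation of `V = (ZMod p)^n` is affine if it has the form
`x ↦ A·x + b` with `A ∈ GL(V)` and `b ∈ V`. -/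
def IsAffinePerm (p n : ℕ) (σ : Equiv.Perm (Fin n → ZMod p)) : Prop :=
  ∃ A : (Fin n → ZMod p) ≃ₗ[ZMod p] (Fin n → ZMod p), ∃ b : Fin n → ZMod p,
    ∀ x, σ x = A x + b

/-- The linear map `(v, t) ↦ (A v + t b, t)` extending the affine map `v ↦ A v + b`. -/
def affineExtension {R M : Type*} [CommRing R] [AddCommGroup M] [Module R M]
    (A : M →ₗ[R] M) (b : M) : Module.End R (M × R) :=
  (A.coprod (LinearMap.toSpanSingleton R M b)).prod (LinearMap.snd R M R)

theorem affineExtension_apply {R M : Type*} [CommRing R] [AddCommGroup M] [Module R M]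
    (A : M →ₗ[R] M) (b v : M) (t : R) :
    affineExtension A b (v, t) = (A v + t • b, t) := by
  simp [affineExtension]

theorem affineExtension_pow_apply_one {R M : Type*} [CommRing R] [AddCommGroup M] [Module R M]
    {A : M →ₗ[R] M} {b : M} {σ : Equiv.Perm M} (hσ : ∀ x, σ x = A x + b) (k : ℕ) (v : M) :
    (affineExtension A b ^ k) (v, 1) = ((σ ^ k) v, 1) := by
  induction k with
  | zero => simp
  | succ k ih => simp [pow_succ', ih, affineExtension_apply, hσ]

theorem affineExtension_pow_eq_one_iff {R M : Type*} [CommRing R] [AddCommGroup M] [Module R M]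
    {A : M →ₗ[R] M} {b : M} {σ : Equiv.Perm M} (hσ : ∀ x, σ x = A x + b) (k : ℕ) :
    affineExtension A b ^ k = 1 ↔ σ ^ k = 1 := by
  have key := affineExtension_pow_apply_one hσ k
  constructor
  · intro h
    ext1 v
    simpa [h] using (congrArg Prod.fst (key v)).symm
  · intro h
    simp only [h, Equiv.Perm.coe_one, id_eq] at key
    ext1
    · ext1 v
      have h0 : ((v, 0) : M × R) = (v, 1) - (0, 1) := by simp
      simp only [LinearMap.comp_apply, LinearMap.inl_apply, Module.End.one_apply]
      rw [h0, map_sub, key, key]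
    · ext1
      simpa using key 0

/-- A linear map of `p`-power order on a space of dimension at most `p` in characteristic `p`
has order dividing `p`. -/
theorem Module.End.pow_char_eq_one_of_finrank_le {F W : Type*} [Field F] [AddCommGroup W]
    [Module F W] [FiniteDimensional F W] {p : ℕ} [Fact p.Prime] [CharP F p]
    (hW : Module.finrank F W ≤ p) {T : Module.End F W} {m : ℕ} (hT : T ^ p ^ m = 1) :
    T ^ p = 1 := by
  cases subsingleton_or_nontrivial W with
  | inl _ => exact Subsingleton.elim _ _
  | inr _ =>
    have : CharP (Module.End F W) p :=
      charP_of_injective_algebraMap (algebraMap F (Module.End F W)).injective p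
    have hnil : (T - 1) ^ p ^ m = 0 := by
      rw [sub_pow_char_pow_of_commute _ _ (Commute.one_right T), hT, one_pow, sub_self]
    have hp : (T - 1) ^ p = 0 :=
      pow_eq_zero_of_le hW (by
        simpa [IsNilpotent.charpoly_eq_X_pow_finrank (φ := T - 1) ⟨_, hnil⟩]
          using (T - 1).aeval_self_charpoly)
    rwa [sub_pow_char_of_commute _ (Commute.one_right T), one_pow, sub_eq_zero] at hp

/-- A vector space over `ZMod p` of order `p ^ n` is isomorphic to `(ZMod p)^n`. -/
theorem ZMod.nonempty_linearEquiv_of_natCard_eq {p n : ℕ} [Fact p.Prime] {A : Type*}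
    [AddCommGroup A] [Module (ZMod p) A] [Finite A] (hcard : Nat.card A = p ^ n) :
    Nonempty (A ≃ₗ[ZMod p] (Fin n → ZMod p)) := by
  have h := Module.natCard_eq_pow_finrank (K := ZMod p) (V := A)
  rw [Nat.card_zmod, hcard] at h
  have hfin := (Nat.pow_right_injective (Fact.out : p.Prime).two_le h).symm
  exact ⟨LinearEquiv.ofFinrankEq A (Fin n → ZMod p) (by simpa using hfin)⟩

theorem regular_abelian_affine_of_dim_lt_prime
    (p n : ℕ) (hp : p.Prime) (hn : 1 ≤ n) (hnp : n < p)
    (K : Subgroup (Equiv.Perm (Fin n → ZMod p)))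
    (haff : ∀ σ ∈ K, IsAffinePerm p n σ)
    (habel : ∀ σ ∈ K, ∀ τ ∈ K, σ * τ = τ * σ)
    -- `K` acts regularly on `V`
    (htrans : ∀ x y : Fin n → ZMod p, ∃ σ ∈ K, σ x = y)
    (hfree : ∀ σ ∈ K, ∀ x : Fin n → ZMod p, σ x = x → σ = 1) :
    (∀ σ ∈ K, σ ^ p = 1) ∧
      Nonempty (K ≃* Multiplicative (Fin n → ZMod p)) := by
  have : Fact p.Prime := ⟨hp⟩
  have hbij : Function.Bijective fun σ : K => σ.1 0 := by
    constructor
    · intro σ τ h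
      have := hfree (τ.1⁻¹ * σ.1) (K.mul_mem (K.inv_mem τ.2) σ.2) 0
        (by simpa using Equiv.Perm.inv_eq_iff_eq.mpr h)
      exact Subtype.ext (inv_mul_eq_one.mp this).symm
    · intro y
      obtain ⟨σ, hσ, h⟩ := htrans 0 y
      exact ⟨⟨σ, hσ⟩, h⟩
  have hcard : Nat.card K = p ^ n := by
    rw [Nat.card_congr (Equiv.ofBijective _ hbij)]
    simp
  have hexp : ∀ σ ∈ K, σ ^ p = 1 := by
    intro σ hσ
    obtain ⟨A, b, hA⟩ := haff σ hσ
    have hA' : ∀ x, σ x = A.toLinearMap x + b := hA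
    rw [← affineExtension_pow_eq_one_iff hA']
    refine Module.End.pow_char_eq_one_of_finrank_le (m := n) (by simpa using hnp) ?_
    rw [affineExtension_pow_eq_one_iff hA', ← hcard]
    exact congrArg Subtype.val (pow_card_eq_one' (x := (⟨σ, hσ⟩ : K)))
  refine ⟨hexp, ?_⟩
  let : CommGroup K := { mul_comm := fun σ τ => Subtype.ext (habel σ σ.2 τ τ.2) }
  let : Module (ZMod p) (Additive K) :=
    AddCommGroup.zmodModule fun σ => Subtype.ext (hexp σ.toMul σ.toMul.2)
  obtain ⟨e⟩ := ZMod.nonempty_linearEquiv_of_natCard_eq (p := p) (n := n) (A := Additive K)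
    ((Nat.card_congr Additive.toMul).trans hcard)
  exact ⟨MulEquiv.toAdditiveLeft.symm e.toAddEquiv⟩
end

section
/- Let p be a prime, n ≥ 1, and V = (ℤ/pℤ)^n. Let AGL(V) be the group of permutations of V of the form x ↦ A·x + b with A ∈ GL(V) and b ∈ V. Suppose K is a subgroup of AGL(V) acting regularly on V and K is cyclic (so K is isomorphic to ℤ/p^nℤ). Then either n = 1, or p = 2 and n = 2. -/
/-- The linear map `(v, t) ↦ (A v + t b, t)` on `V × R` attached to the affine map
`v ↦ A v + b` of `V`. -/
def affineHomogenization {R V : Type*} [CommRing R] [AddCommGroup V] [Module R V]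
    (A : V →ₗ[R] V) (b : V) : Module.End R (V × R) :=
  (A.coprod (LinearMap.toSpanSingleton R V b)).prod (LinearMap.snd R V R)

theorem affineHomogenization_pow_apply {R V : Type*} [CommRing R] [AddCommGroup V] [Module R V]
    {A : V →ₗ[R] V} {b : V} {σ : Equiv.Perm V} (h : ∀ x, σ x = A x + b) (k : ℕ) (v : V) :
    (affineHomogenization A b ^ k) (v, 1) = ((σ ^ k) v, 1) := by
  induction k with
  | zero => simp
  | succ k ih =>
    rw [pow_succ', Module.End.mul_apply, ih, pow_succ', Equiv.Perm.mul_apply, h]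
    simp [affineHomogenization]

theorem LinearMap.ext_of_apply_prodMk_one {R V W : Type*} [CommRing R] [AddCommGroup V]
    [Module R V] [AddCommGroup W] [Module R W] {f g : V × R →ₗ[R] W}
    (h : ∀ v, f (v, 1) = g (v, 1)) : f = g := by
  ext x
  · have key : ((x, 0) : V × R) = (x, 1) - (0, 1) := by simp
    simp only [LinearMap.comp_apply, LinearMap.inl_apply]
    rw [key, map_sub, map_sub, h, h]
  · simpa using h 0

/-- A linear endomorphism `M` of `p`-power order in characteristic `p` satisfies `M ^ p ^ k = 1`
as soon as `p ^ k` is at least the dimension. -/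
theorem Module.End.pow_char_pow_eq_one_of_finrank_le {F W : Type*} [Field F] [AddCommGroup W]
    [Module F W] [FiniteDimensional F W] [Nontrivial W]
    (p : ℕ) [Fact p.Prime] [CharP F p] {M : Module.End F W} {m k : ℕ}
    (hM : M ^ p ^ m = 1) (hk : Module.finrank F W ≤ p ^ k) :
    M ^ p ^ k = 1 := by
  have : CharP (Module.End F W) p :=
    charP_of_injective_algebraMap (algebraMap F (Module.End F W)).injective p
  have hpow : ∀ j, (M - 1) ^ p ^ j = M ^ p ^ j - 1 := fun j ↦ by
    rw [sub_pow_char_pow_of_commute _ _ (Commute.one_right M), one_pow]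
  have hnil : IsNilpotent (M - 1) := ⟨p ^ m, by rw [hpow, hM, sub_self]⟩
  have hfin : (M - 1) ^ Module.finrank F W = 0 := by
    have hch := LinearMap.aeval_self_charpoly (M - 1)
    rwa [IsNilpotent.charpoly_eq_X_pow_finrank hnil, map_pow, Polynomial.aeval_X] at hch
  rw [← sub_eq_zero, ← hpow]
  exact pow_eq_zero_of_le hk hfin

theorem Nat.succ_le_pow_pred {p n : ℕ} (hp : 2 ≤ p) (hn : 2 ≤ n) (h : ¬(p = 2 ∧ n = 2)) :
    n + 1 ≤ p ^ (n - 1) := by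
  obtain ⟨m, rfl⟩ := Nat.exists_eq_add_of_le' hn
  obtain rfl | hm := Nat.eq_zero_or_pos m
  · simp
    omega
  · refine le_trans ?_ (Nat.pow_le_pow_left hp _)
    clear h hn
    induction m, hm using Nat.le_induction with
    | base => norm_num
    | succ m hm ih =>
      have : m + 1 + 2 - 1 = (m + 2 - 1) + 1 := by omega
      rw [this, pow_succ]
      omega

theorem regular_cyclic_affine_implies
    (p n : ℕ) (hp : p.Prime) (hn : 1 ≤ n)
    (K : Subgroup (Equiv.Perm (Fin n → ZMod p)))
    (haff : ∀ σ ∈ K, IsAffinePerm p n σ)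
    (hcyc : IsCyclic K)
    -- `K` acts regularly on `V`
    (htrans : ∀ x y : Fin n → ZMod p, ∃ σ ∈ K, σ x = y)
    (hfree : ∀ σ ∈ K, ∀ x : Fin n → ZMod p, σ x = x → σ = 1) :
    n = 1 ∨ (p = 2 ∧ n = 2) := by
  have : Fact p.Prime := ⟨hp⟩
  by_contra! hcon
  have hcard : Nat.card K = p ^ n := by
    have hbij : Function.Bijective fun k : K ↦ k.1 0 := by
      refine ⟨fun k l hkl ↦ ?_, fun y ↦ ?_⟩
      · have := hfree _ (K.mul_mem (K.inv_mem l.2) k.2) 0 (by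
          simp only at hkl
          simp [hkl])
        exact Subtype.ext (inv_mul_eq_one.mp this).symm
      · obtain ⟨σ, hσ, hy⟩ := htrans 0 y
        exact ⟨⟨σ, hσ⟩, hy⟩
    rw [Nat.card_eq_of_bijective _ hbij]
    simp
  obtain ⟨g, hg⟩ := hcyc.exists_generator
  have hord : orderOf g = p ^ n := by
    rw [orderOf_eq_card_of_forall_mem_zpowers hg, hcard]
  obtain ⟨A, b, hA⟩ := haff g g.2
  have hpow_iff : ∀ k, affineHomogenization A.toLinearMap b ^ k = 1 ↔ g ^ k = 1 := by
    intro k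
    rw [← Subtype.coe_inj, Subgroup.coe_pow, Subgroup.coe_one]
    constructor
    · intro h
      ext1 v
      have := affineHomogenization_pow_apply (A := A.toLinearMap) hA k v
      rw [h] at this
      exact (congrArg Prod.fst this).symm
    · intro h
      refine LinearMap.ext_of_apply_prodMk_one fun v ↦ ?_
      rw [affineHomogenization_pow_apply (A := A.toLinearMap) hA, h]
      rfl
  have hlow : g ^ p ^ (n - 1) = 1 := by
    refine (hpow_iff _).mp (Module.End.pow_char_pow_eq_one_of_finrank_le p
      ((hpow_iff (p ^ n)).mpr (by rw [← hord, pow_orderOf_eq_one])) ?_)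
    simpa using Nat.succ_le_pow_pred hp.two_le (by omega) fun h ↦ hcon.2 h.1 h.2
  have hle := Nat.le_of_dvd (pow_pos hp.pos _) (orderOf_dvd_of_pow_eq_one hlow)
  rw [hord] at hle
  exact absurd hle (not_le.mpr (Nat.pow_lt_pow_right hp.one_lt (by omega)))
end
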